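/- (Simon) Let f ∈ L^1(G^2) and β ≥ 1 be a fixed parameter. Then the two-dimensional Walsh–Kaczmarz–Fejér means σ_n^κ f(x) converge to f(x) for almost every x ∈ G^2 as min(n_1,n_2) → ∞ subject to the cone restriction β^{-1} ≤ n_1/n_2 ≤ β. -/

import Mathlib

open MeasureTheory Filter Finset ENNReal

noncomputable section

/-- The Walsh group `G`: countable product of copies of `ℤ/2ℤ`. -/
abbrev WG : Type := ℕ → ZMod 2

/-- The normalized Haar measure (= product of uniform coin-toss measures) on `G`. -/
def μW : Measure WG := Measure.addHaarMeasure ⊤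

instance : (μW).Regular := by unfold μW; infer_instance

instance : IsFiniteMeasure μW := by
  constructor
  rw [← TopologicalSpace.PositiveCompacts.coe_top (α := WG)]
  exact IsCompact.measure_lt_top (⊤ : TopologicalSpace.PositiveCompacts WG).isCompact

/-- The product measure on `G^d`. -/
def μD (d : ℕ) : Measure (Fin d → WG) := Measure.pi fun _ => μW

/-- The `k`-th Rademacher function. -/
def rad (k : ℕ) (x : WG) : ℝ := (-1 : ℝ) ^ (x k).val

/-- The Walsh–Paley function of index `n`. -/
def walsh (n : ℕ) (x : WG) : ℝ :=
  ∏ k ∈ Finset.range n.size, if n.testBit k then rad k x else 1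

/-- The Walsh–Kaczmarz function of index `n`; `Nat.log 2 n` is the order `|n|`. -/
def kacz (n : ℕ) (x : WG) : ℝ :=
  if n = 0 then 1 else
    rad (Nat.log 2 n) x *
      (-1 : ℝ) ^ (∑ k ∈ Finset.range (Nat.log 2 n),
        (if n.testBit k then 1 else 0) * (x (Nat.log 2 n - 1 - k)).val)

/-- The `d`-dimensional Walsh–Kaczmarz function. -/
def kaczD (d : ℕ) (m : Fin d → ℕ) (x : Fin d → WG) : ℝ := ∏ i, kacz (m i) (x i)

/-- Walsh–Paley Dirichlet kernel. -/
def dirW (n : ℕ) (x : WG) : ℝ := ∑ k ∈ Finset.range n, walsh k x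

/-- Walsh–Kaczmarz Dirichlet kernel. -/
def dirK (n : ℕ) (x : WG) : ℝ := ∑ k ∈ Finset.range n, kacz k x

/-- `A_j^α = binom (j+α) j`. -/
def Abin (α : ℝ) (j : ℕ) : ℝ := ∏ i ∈ Finset.range j, (α + i + 1) / (i + 1)

/-- One-dimensional Walsh–Paley `(C,α)` kernel. -/
def KW (α : ℝ) (n : ℕ) (x : WG) : ℝ :=
  (Abin α n)⁻¹ * ∑ k ∈ Finset.range (n + 1), Abin (α - 1) (n - k) * dirW k x

/-- One-dimensional Walsh–Kaczmarz `(C,α)` kernel. -/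
def KK (α : ℝ) (n : ℕ) (x : WG) : ℝ :=
  (Abin α n)⁻¹ * ∑ k ∈ Finset.range (n + 1), Abin (α - 1) (n - k) * dirK k x

/-- The `m`-th Walsh–Kaczmarz–Fourier coefficient of `f : G^d → ℝ`. -/
def fCoeff (d : ℕ) (f : (Fin d → WG) → ℝ) (m : Fin d → ℕ) : ℝ :=
  ∫ x, f x * kaczD d m x ∂ μD d

/-- Rectangular partial sum built from an abstract family `c` of Fourier coefficients. -/
def partialSumOf (d : ℕ) (c : (Fin d → ℕ) → ℝ) (k : Fin d → ℕ) (x : Fin d → WG) : ℝ :=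
  ∑ m ∈ Fintype.piFinset (fun i => Finset.range (k i)), c m * kaczD d m x

/-- `(C,α)` (Cesàro) mean of order `n` built from coefficients `c`. -/
def cesaroOf (d : ℕ) (α : Fin d → ℝ) (c : (Fin d → ℕ) → ℝ) (n : Fin d → ℕ)
    (x : Fin d → WG) : ℝ :=
  (∏ i, Abin (α i) (n i))⁻¹ *
    ∑ k ∈ Fintype.piFinset (fun i => Finset.range (n i + 1)),
      (∏ i, Abin (α i - 1) (n i - k i)) * partialSumOf d c k x

/-- A cone-like restriction function (CRF) family `γ = (γ_j)_{j ≠ 0}`. -/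
structure IsCRF (d : ℕ) [NeZero d] (γ : Fin d → ℝ → ℝ) : Prop where
  strictMono : ∀ j : Fin d, j ≠ 0 → StrictMonoOn (γ j) (Set.Ici 1)
  contOn : ∀ j : Fin d, j ≠ 0 → ContinuousOn (γ j) (Set.Ici 1)
  one_le : ∀ j : Fin d, j ≠ 0 → ∀ x : ℝ, 1 ≤ x → 1 ≤ γ j x
  map_one : ∀ j : Fin d, j ≠ 0 → γ j 1 = 1
  tendsto_atTop : ∀ j : Fin d, j ≠ 0 → Tendsto (γ j) atTop atTop
  reg : ∃ ζ : ℝ, 1 < ζ ∧ ∀ j : Fin d, j ≠ 0 → ∃ c₁ c₂ : ℝ, 1 < c₁ ∧ 1 < c₂ ∧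
    ∀ x : ℝ, 1 ≤ x → c₁ * γ j x ≤ γ j (ζ * x) ∧ γ j (ζ * x) ≤ c₂ * γ j x

/-- The cone-like set `L` determined by `γ` and the parameters `β`. -/
def coneLike (d : ℕ) [NeZero d] (γ : Fin d → ℝ → ℝ) (β : Fin d → ℝ) : Set (Fin d → ℕ) :=
  {n | ∀ j : Fin d, j ≠ 0 → (β j)⁻¹ * γ j (n 0) ≤ (n j : ℝ) ∧ (n j : ℝ) ≤ β j * γ j (n 0)}

/-- `bar γ n₁ = (n₁, n₂, …, n_d)` where `n_j = |γ_j(2^{n₁})|` is the order of `γ_j(2^{n₁})`,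
i.e. `2^{n_j} ≤ γ_j(2^{n₁}) < 2^{n_j+1}`. -/
def bar (d : ℕ) [NeZero d] (γ : Fin d → ℝ → ℝ) (n₁ : ℕ) : Fin d → ℕ :=
  fun j => if j = 0 then n₁ else Nat.log 2 ⌊γ j ((2 : ℝ) ^ n₁)⌋₊

/-- The cone-like restricted maximal operator `σ_L^{κ,α,*}` (built from coefficients `c`). -/
def cesaroMaximal (d : ℕ) [NeZero d] (α : Fin d → ℝ) (γ : Fin d → ℝ → ℝ) (β : Fin d → ℝ)
    (c : (Fin d → ℕ) → ℝ) (x : Fin d → WG) : ℝ≥0∞ :=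
  ⨆ n ∈ coneLike d γ β, ENNReal.ofReal |cesaroOf d α c n x|

/-- `L^p`-"norm" (`0 < p < ∞`) of an `ℝ≥0∞`-valued function on `G^d`. -/
def lpNormE (d : ℕ) (p : ℝ) (g : (Fin d → WG) → ℝ≥0∞) : ℝ≥0∞ :=
  (∫⁻ x, g x ^ p ∂ μD d) ^ (1 / p)

/-- The dyadic rectangle `I_{N}(y) = I_{N_1}(y^1) × ⋯ × I_{N_d}(y^d)`. -/
def rectAt (d : ℕ) (N : Fin d → ℕ) (y : Fin d → WG) : Set (Fin d → WG) :=
  {x | ∀ j : Fin d, ∀ i : ℕ, i < N j → x j i = y j i}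

/-- The one-dimensional dyadic interval `I_N = I_N(0)`. -/
def rectW (N : ℕ) : Set WG := {x | ∀ i : ℕ, i < N → x i = 0}

/-- A one-parameter martingale with respect to the filtration
`(F_{bar γ n₁})_{n₁}` generated by the dyadic rectangles `I_{bar γ n₁}(y)`
(measurability w.r.t. this atomic σ-algebra = being constant on its rectangles,
and the martingale property = equality of integrals over the rectangles). -/
structure ConeMartingale (d : ℕ) [NeZero d] (γ : Fin d → ℝ → ℝ) where
  F : ℕ → (Fin d → WG) → ℝ
  integrable : ∀ n₁, Integrable (F n₁) (μD d)
  adapted : ∀ n₁ (x y : Fin d → WG),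
    (∀ j : Fin d, ∀ i : ℕ, i < bar d γ n₁ j → x j i = y j i) → F n₁ x = F n₁ y
  mart : ∀ n₁ m₁, n₁ ≤ m₁ → ∀ y,
    ∫ x in rectAt d (bar d γ n₁) y, F m₁ x ∂ μD d
      = ∫ x in rectAt d (bar d γ n₁) y, F n₁ x ∂ μD d

/-- The Fourier coefficients of a martingale (the integrals `∫ f_k ψ_m` stabilize). -/
def martCoeff (d : ℕ) [NeZero d] (γ : Fin d → ℝ → ℝ) (f : ConeMartingale d γ) (m : Fin d → ℕ) : ℝ :=
  limUnder atTop (fun k => ∫ x, f.F k x * kaczD d m x ∂ μD d)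

/-- The maximal function `f* = sup_{n₁} |f_{bar n₁}|` of a martingale. -/
def martMaximal (d : ℕ) [NeZero d] (γ : Fin d → ℝ → ℝ) (f : ConeMartingale d γ)
    (x : Fin d → WG) : ℝ≥0∞ :=
  ⨆ n₁ : ℕ, ENNReal.ofReal |f.F n₁ x|

/-- The martingale Hardy space "norm" `‖f‖_{H_p^γ} = ‖f*‖_p`. -/
def hardyNorm (d : ℕ) [NeZero d] (γ : Fin d → ℝ → ℝ) (p : ℝ) (f : ConeMartingale d γ) : ℝ≥0∞ :=
  lpNormE d p (martMaximal d γ f)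

/-- A `p`-atom supported on the rectangle `I_N(y)`. -/
structure IsPAtom (d : ℕ) (p : ℝ) (a : (Fin d → WG) → ℝ) (N : Fin d → ℕ)
    (y : Fin d → WG) : Prop where
  measurable : Measurable a
  support : ∀ x, x ∉ rectAt d N y → a x = 0
  bound : ∀ x, |a x| ≤ ((μD d (rectAt d N y)).toReal) ^ (-(1 / p))
  zero : ∫ x, a x ∂ μD d = 0

/-- The conditional-expectation (dyadic average) of `f` at level `N`. -/
def avgAt (d : ℕ) (N : Fin d → ℕ) (f : (Fin d → WG) → ℝ) (x : Fin d → WG) : ℝ :=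
  (2 : ℝ) ^ (∑ j, N j) * ∫ t in rectAt d N x, f t ∂ μD d

/-- `m` is the martingale generated by the integrable function `f`. -/
def inducedLevels (d : ℕ) [NeZero d] (γ : Fin d → ℝ → ℝ) (f : (Fin d → WG) → ℝ)
    (m : ConeMartingale d γ) : Prop :=
  ∀ n₁ x, m.F n₁ x = avgAt d (bar d γ n₁) f x

/-- The martingale maximal function of (the martingale generated by) a function `f`,
`f* = sup_{n₁} |S_{2^{bar γ n₁}} f|`. -/
def funMaximal (d : ℕ) [NeZero d] (γ : Fin d → ℝ → ℝ) (f : (Fin d → WG) → ℝ)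
    (x : Fin d → WG) : ℝ≥0∞ :=
  ⨆ n₁ : ℕ, ENNReal.ofReal |partialSumOf d (fCoeff d f) (fun j => 2 ^ bar d γ n₁ j) x|

/-- The Hardy norm `‖f‖_{H_p^γ}` of (the martingale generated by) a function `f`. -/
def funHardyNorm (d : ℕ) [NeZero d] (γ : Fin d → ℝ → ℝ) (p : ℝ) (f : (Fin d → WG) → ℝ) : ℝ≥0∞ :=
  lpNormE d p (funMaximal d γ f)

/-- Skvortsov's bit-reversal transformation `τ_A`. -/
def tau (A : ℕ) (x : WG) : WG := fun i => if i < A then x (A - 1 - i) else x i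

end

noncomputable section

/-- The two-dimensional Walsh–Kaczmarz–Fejér mean
`σ_n^κ f = (n₁n₂)⁻¹ Σ_{k₁=1}^{n₁} Σ_{k₂=1}^{n₂} S_{(k₁,k₂)}^κ f`. -/
def fejer2 (f : (Fin 2 → WG) → ℝ) (n : Fin 2 → ℕ) (x : Fin 2 → WG) : ℝ :=
  ((n 0 : ℝ) * (n 1 : ℝ))⁻¹ *
    ∑ k₁ ∈ Finset.Icc 1 (n 0), ∑ k₂ ∈ Finset.Icc 1 (n 1),
      partialSumOf 2 (fCoeff 2 f) (fun i => if i = 0 then k₁ else k₂) x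

lemma rad_eq (k : ℕ) (x : WG) : (x k = 0 ∧ rad k x = 1) ∨ (x k = 1 ∧ rad k x = -1) := by
  unfold rad
  generalize x k = a
  have ha : a = 0 ∨ a = 1 := by
    revert a
    decide
  rcases ha with rfl | rfl
  · simp
  · right
    simp [ZMod.val_one]

lemma rad_add (k : ℕ) (x y : WG) : rad k (x + y) = rad k x * rad k y := by
  have h11 : (1 : ZMod 2) + 1 = 0 := by decide
  rcases rad_eq k x with ⟨h1, h2⟩ | ⟨h1, h2⟩ <;> rcases rad_eq k y with ⟨h3, h4⟩ | ⟨h3, h4⟩ <;>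
    rw [h2, h4] <;> simp [rad, h1, h3, h11, ZMod.val_one]

lemma continuous_rad (k : ℕ) : Continuous (rad k) :=
  (continuous_of_discreteTopology (f := fun a : ZMod 2 => (-1 : ℝ) ^ a.val)).comp
    (continuous_apply k)

instance isProbabilityMeasure_μW : IsProbabilityMeasure μW := by
  constructor
  have h := Measure.addHaarMeasure_self (K₀ := (⊤ : TopologicalSpace.PositiveCompacts WG))
  rwa [TopologicalSpace.PositiveCompacts.coe_top] at h

instance isAddLeftInvariant_μW : (μW).IsAddLeftInvariant := by unfold μW; infer_instance

instance isProbabilityMeasure_μD (d : ℕ) : IsProbabilityMeasure (μD d) := by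
  unfold μD; infer_instance

instance isAddLeftInvariant_μD (d : ℕ) : (μD d).IsAddLeftInvariant := by
  unfold μD; infer_instance

instance regular_μD_two : (μD 2).Regular := by
  have : TopologicalSpace.PseudoMetrizableSpace WG := inferInstance
  infer_instance

/-- The Riesz product `∏_{l ∈ S} (1 + r_l)`: the normalized indicator of the subgroup of points
whose coordinates in `S` vanish. -/
def riesz (S : Finset ℕ) (z : WG) : ℝ := ∏ l ∈ S, (1 + rad l z)

lemma one_add_rad_nonneg (l : ℕ) (z : WG) : 0 ≤ 1 + rad l z := by
  rcases rad_eq l z with ⟨_, h⟩ | ⟨_, h⟩ <;> rw [h] <;> norm_num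

lemma riesz_nonneg (S : Finset ℕ) (z : WG) : 0 ≤ riesz S z :=
  prod_nonneg fun l _ => one_add_rad_nonneg l z

lemma riesz_eq_zero {S : Finset ℕ} {z : WG} {l : ℕ} (hl : l ∈ S) (hz : z l ≠ 0) :
    riesz S z = 0 := by
  refine prod_eq_zero hl ?_
  rcases rad_eq l z with ⟨h, _⟩ | ⟨_, h⟩
  · exact absurd h hz
  · rw [h]; norm_num

lemma riesz_le_two_mul_riesz_erase (S : Finset ℕ) (t : ℕ) (z : WG) :
    riesz S z ≤ 2 * riesz (S.erase t) z := by
  have h0 := riesz_nonneg (S.erase t) z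
  by_cases ht : t ∈ S
  · have h : riesz S z = (1 + rad t z) * riesz (S.erase t) z := by
      unfold riesz; rw [mul_prod_erase S (fun l => 1 + rad l z) ht]
    rw [h]
    refine mul_le_mul_of_nonneg_right ?_ h0
    rcases rad_eq t z with ⟨_, h⟩ | ⟨_, h⟩ <;> rw [h] <;> norm_num
  · rw [erase_eq_of_notMem ht] at h0 ⊢
    linarith

lemma continuous_riesz (S : Finset ℕ) : Continuous (riesz S) :=
  continuous_finsetProd S fun l _ => continuous_const.add (continuous_rad l)

/-- The two-dimensional Riesz product. -/
def riesz₂ (S T : Finset ℕ) (z : Fin 2 → WG) : ℝ := riesz S (z 0) * riesz T (z 1)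

lemma riesz₂_nonneg (S T : Finset ℕ) (z : Fin 2 → WG) : 0 ≤ riesz₂ S T z :=
  mul_nonneg (riesz_nonneg _ _) (riesz_nonneg _ _)

lemma continuous_riesz₂ (S T : Finset ℕ) : Continuous (riesz₂ S T) :=
  ((continuous_riesz S).comp (continuous_apply 0)).mul
    ((continuous_riesz T).comp (continuous_apply 1))

lemma measurable_riesz₂_add (S T : Finset ℕ) :
    Measurable fun p : (Fin 2 → WG) × (Fin 2 → WG) => riesz₂ S T (p.1 + p.2) := by
  have h : ∀ (l : ℕ) (j : Fin 2), Measurable fun p : (Fin 2 → WG) × (Fin 2 → WG) =>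
      1 + rad l (p.1 j + p.2 j) := by
    intro l j
    simp only [rad_add]
    have := (continuous_rad l).measurable
    fun_prop
  exact (Finset.measurable_fun_prod S fun l _ => h l 0).mul
    (Finset.measurable_fun_prod T fun l _ => h l 1)

lemma integral_eq_zero_of_antiinvariant {h : (Fin 2 → WG) → ℝ} (e : Fin 2 → WG)
    (he : ∀ z, h (e + z) = -h z) : ∫ z, h z ∂μD 2 = 0 := by
  have h1 := integral_add_left_eq_self (μ := μD 2) h e
  simp only [he, integral_neg] at h1
  linarith

lemma integrable_of_continuous {h : (Fin 2 → WG) → ℝ} (hc : Continuous h) :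
    Integrable h (μD 2) :=
  hc.integrable_of_hasCompactSupport (HasCompactSupport.of_compactSpace h)

lemma rad_single (l k : ℕ) :
    rad l (Pi.single k 1 : WG) = if l = k then -1 else 1 := by
  unfold rad
  by_cases h : l = k
  · subst h; simp [ZMod.val_one]
  · simp [h]

lemma riesz_single_add {S : Finset ℕ} {k : ℕ} (hk : k ∉ S) (z : WG) :
    riesz S (Pi.single k 1 + z) = riesz S z := by
  refine prod_congr rfl fun l hl => ?_
  have h : l ≠ k := fun h => hk (h ▸ hl)
  rw [rad_add, rad_single, if_neg h, one_mul]

lemma integral_riesz₂ (S T : Finset ℕ) : ∫ z, riesz₂ S T z ∂μD 2 = 1 := by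
  induction S using Finset.induction_on with
  | empty =>
    induction T using Finset.induction_on with
    | empty => simp [riesz₂, riesz]
    | insert l T hl ih =>
      have h : ∀ z, riesz₂ ∅ (insert l T) z
          = riesz₂ ∅ T z + rad l (z 1) * riesz₂ ∅ T z := by
        intro z
        simp only [riesz₂, riesz, prod_insert hl]; ring
      simp only [h]
      have hc := continuous_riesz₂ ∅ T
      have hr : Continuous fun z : Fin 2 → WG => rad l (z 1) :=
        (continuous_rad l).comp (continuous_apply 1)
      rw [integral_add (integrable_of_continuous hc) (integrable_of_continuous (hr.fun_mul hc)), ih,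
        integral_eq_zero_of_antiinvariant (Pi.single 1 (Pi.single l 1)), add_zero]
      intro z
      simp [riesz₂, riesz_single_add hl, rad_add, rad_single]
  | insert l S hl ih =>
    have h : ∀ z, riesz₂ (insert l S) T z
        = riesz₂ S T z + rad l (z 0) * riesz₂ S T z := by
      intro z
      simp only [riesz₂, riesz, prod_insert hl]; ring
    simp only [h]
    have hc := continuous_riesz₂ S T
    have hr : Continuous fun z : Fin 2 → WG => rad l (z 0) :=
      (continuous_rad l).comp (continuous_apply 0)
    rw [integral_add (integrable_of_continuous hc) (integrable_of_continuous (hr.fun_mul hc)), ih,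
      integral_eq_zero_of_antiinvariant (Pi.single 0 (Pi.single l 1)), add_zero]
    intro z
    simp [riesz₂, riesz_single_add hl, rad_add, rad_single]

lemma lintegral_riesz₂_add (S T : Finset ℕ) (y : Fin 2 → WG) :
    ∫⁻ x, ENNReal.ofReal (riesz₂ S T (x + y)) ∂μD 2 = 1 := by
  simp_rw [add_comm _ y]
  rw [lintegral_add_left_eq_self (μ := μD 2) (fun x => ENNReal.ofReal (riesz₂ S T x)),
    ← ofReal_integral_eq_lintegral_ofReal (integrable_of_continuous (continuous_riesz₂ S T))
      (ae_of_all _ (riesz₂_nonneg S T)), integral_riesz₂, ENNReal.ofReal_one]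

/-- The average of `g` over the coordinates outside `S` and `T`. -/
def avgOff (S T : Finset ℕ) (g : (Fin 2 → WG) → ℝ≥0∞) (x : Fin 2 → WG) : ℝ≥0∞ :=
  ∫⁻ y, g y * ENNReal.ofReal (riesz₂ S T (x + y)) ∂μD 2

lemma measurable_mul_riesz₂_add (S T : Finset ℕ) {g : (Fin 2 → WG) → ℝ≥0∞} (hg : Measurable g) :
    Measurable fun p : (Fin 2 → WG) × (Fin 2 → WG) =>
      g p.2 * ENNReal.ofReal (riesz₂ S T (p.1 + p.2)) :=
  (hg.comp measurable_snd).mul (measurable_riesz₂_add S T).ennreal_ofReal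

lemma measurable_avgOff (S T : Finset ℕ) {g : (Fin 2 → WG) → ℝ≥0∞} (hg : Measurable g) :
    Measurable (avgOff S T g) :=
  (measurable_mul_riesz₂_add S T hg).lintegral_prod_right'

lemma WG_add_eq_zero {x y : WG} {l : ℕ} (h : x l ≠ y l) : (x + y) l ≠ 0 := by
  have hd : ∀ a b : ZMod 2, a ≠ b → a + b ≠ 0 := by decide
  exact hd _ _ h

lemma riesz₂_add_eq_zero {S T : Finset ℕ} {x y : Fin 2 → WG}
    (h : ¬ ((∀ l ∈ S, x 0 l = y 0 l) ∧ ∀ l ∈ T, x 1 l = y 1 l)) : riesz₂ S T (x + y) = 0 := by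
  rw [not_and_or] at h
  push Not at h
  unfold riesz₂
  rcases h with ⟨l, hl, h⟩ | ⟨l, hl, h⟩
  · rw [Pi.add_apply, riesz_eq_zero hl (WG_add_eq_zero h), zero_mul]
  · rw [Pi.add_apply x y 1, riesz_eq_zero hl (WG_add_eq_zero h), mul_zero]

lemma riesz₂_congr {S T : Finset ℕ} {x x' : Fin 2 → WG}
    (h0 : ∀ l ∈ S, x 0 l = x' 0 l) (h1 : ∀ l ∈ T, x 1 l = x' 1 l) :
    riesz₂ S T x = riesz₂ S T x' := by
  unfold riesz₂ riesz rad
  congr 1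
  · exact prod_congr rfl fun l hl => by rw [h0 l hl]
  · exact prod_congr rfl fun l hl => by rw [h1 l hl]

lemma avgOff_congr {S T : Finset ℕ} (g : (Fin 2 → WG) → ℝ≥0∞) {x x' : Fin 2 → WG}
    (h0 : ∀ l ∈ S, x 0 l = x' 0 l) (h1 : ∀ l ∈ T, x 1 l = x' 1 l) :
    avgOff S T g x = avgOff S T g x' := by
  unfold avgOff
  congr 1 with y
  rw [riesz₂_congr (x' := x' + y)] <;> intro l hl
  · simp [h0 l hl]
  · simp [h1 l hl]

/-- The average of `g` over a set determined by the coordinates in `S` and `T` is preserved. -/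
lemma setLIntegral_avgOff {S T : Finset ℕ} {g : (Fin 2 → WG) → ℝ≥0∞} (hg : Measurable g)
    {B : Set (Fin 2 → WG)} (hB : MeasurableSet B)
    (hBd : ∀ x y, (∀ l ∈ S, x 0 l = y 0 l) → (∀ l ∈ T, x 1 l = y 1 l) → x ∈ B → y ∈ B) :
    ∫⁻ x in B, avgOff S T g x ∂μD 2 = ∫⁻ x in B, g x ∂μD 2 := by
  have hswap := lintegral_lintegral_swap (μ := (μD 2).restrict B) (ν := μD 2)
    (f := fun x y => g y * ENNReal.ofReal (riesz₂ S T (x + y)))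
    (measurable_mul_riesz₂_add S T hg).aemeasurable
  rw [← lintegral_indicator hB g]
  unfold avgOff
  rw [hswap]
  refine lintegral_congr fun y => ?_
  have hm : Measurable fun x => ENNReal.ofReal (riesz₂ S T (x + y)) :=
    ((continuous_riesz₂ S T).comp (continuous_add_const y)).measurable.ennreal_ofReal
  rw [lintegral_const_mul _ hm, ← lintegral_indicator hB]
  have key : ∀ x, B.indicator (fun x => ENNReal.ofReal (riesz₂ S T (x + y))) x
      = B.indicator 1 y * ENNReal.ofReal (riesz₂ S T (x + y)) := by
    intro x
    by_cases h : (∀ l ∈ S, x 0 l = y 0 l) ∧ ∀ l ∈ T, x 1 l = y 1 l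
    · have hxy : x ∈ B ↔ y ∈ B :=
        ⟨hBd x y h.1 h.2, hBd y x (fun l hl => (h.1 l hl).symm) fun l hl => (h.2 l hl).symm⟩
      by_cases hy : y ∈ B
      · simp [hy, hxy.2 hy]
      · simp [hy, hxy]
    · simp [Set.indicator, riesz₂_add_eq_zero h]
  simp_rw [key]
  rw [lintegral_const_mul _ hm, lintegral_riesz₂_add, mul_one]
  by_cases hy : y ∈ B <;> simp [hy]

/-- Doob's weak type inequality for the averages along an increasing sequence of coordinates. -/
lemma weak_type_avgOff {S T : ℕ → Finset ℕ} (hS : Monotone S) (hT : Monotone T)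
    {g : (Fin 2 → WG) → ℝ≥0∞} (hg : Measurable g) (c : ℝ≥0∞) :
    c * μD 2 {x | ∃ k, c < avgOff (S k) (T k) g x} ≤ ∫⁻ x, g x ∂μD 2 := by
  set B : ℕ → Set (Fin 2 → WG) := fun k =>
    {x | c < avgOff (S k) (T k) g x} ∩ ⋂ j < k, {x | avgOff (S j) (T j) g x ≤ c} with hBdef
  have hm : ∀ k, MeasurableSet (B k) := by
    intro k
    refine (measurableSet_lt measurable_const (measurable_avgOff _ _ hg)).inter ?_
    exact MeasurableSet.biInter (Set.to_countable _) fun j _ =>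
      measurableSet_le (measurable_avgOff _ _ hg) measurable_const
  have hU : {x | ∃ k, c < avgOff (S k) (T k) g x} = ⋃ k, B k := by
    ext x
    simp only [Set.mem_ofPred_eq, Set.mem_iUnion, hBdef, Set.mem_inter_iff, Set.mem_iInter]
    constructor
    · intro h
      classical
      exact ⟨Nat.find h, Nat.find_spec h, fun j hj => not_lt.1 (Nat.find_min h hj)⟩
    · rintro ⟨k, h, _⟩
      exact ⟨k, h⟩
  have hdisj : Pairwise (Function.onFun Disjoint B) := by
    have aux : ∀ i j, i < j → Disjoint (B i) (B j) := by
      intro i j hij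
      rw [Set.disjoint_left]
      rintro x ⟨h1, _⟩ ⟨_, h2⟩
      simp only [Set.mem_iInter, Set.mem_ofPred_eq] at h1 h2
      exact absurd h1 (not_lt.2 (h2 i hij))
    intro i j hij
    rcases lt_or_gt_of_ne hij with h | h
    · exact aux i j h
    · exact (aux j i h).symm
  have hk : ∀ k, c * μD 2 (B k) ≤ ∫⁻ x in B k, g x ∂μD 2 := by
    intro k
    rw [← setLIntegral_avgOff (S := S k) (T := T k) hg (hm k)]
    · rw [← setLIntegral_const]
      exact setLIntegral_mono (measurable_avgOff _ _ hg) fun x hx => hx.1.le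
    · intro x y h0 h1 hx
      have hj : ∀ j ≤ k, avgOff (S j) (T j) g x = avgOff (S j) (T j) g y := fun j hj =>
        avgOff_congr g (fun l hl => h0 l (hS hj hl)) fun l hl => h1 l (hT hj hl)
      refine ⟨?_, ?_⟩
      · have := hx.1
        rwa [Set.mem_ofPred_eq, hj k le_rfl] at this
      · have := hx.2
        simp only [Set.mem_iInter, Set.mem_ofPred_eq] at this ⊢
        intro j hjk
        rw [← hj j hjk.le]
        exact this j hjk
  rw [hU, measure_iUnion hdisj hm, ← ENNReal.tsum_mul_left]
  calc ∑' k, c * μD 2 (B k) ≤ ∑' k, ∫⁻ x in B k, g x ∂μD 2 := ENNReal.tsum_le_tsum hk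
    _ = ∫⁻ x in ⋃ k, B k, g x ∂μD 2 := (lintegral_iUnion hm hdisj g).symm
    _ ≤ ∫⁻ x, g x ∂μD 2 := setLIntegral_le_lintegral _ _

/-- Partial sums `D_n = ∑_{q < n} w_q` of a sequence. -/
def partSum (w : ℕ → ℝ) (n : ℕ) : ℝ := ∑ q ∈ range n, w q

/-- Sums `∑_{k = 1}^n D_k` of the partial sums of a sequence. -/
def cesSum (w : ℕ → ℝ) (n : ℕ) : ℝ := ∑ k ∈ range n, partSum w (k + 1)

lemma partSum_add {w w' : ℕ → ℝ} {c : ℝ} {N : ℕ} (h : ∀ q < N, w (N + q) = c * w' q) {m : ℕ}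
    (hm : m ≤ N) : partSum w (N + m) = partSum w N + c * partSum w' m := by
  unfold partSum
  rw [sum_range_add, mul_sum]
  congr 1
  exact sum_congr rfl fun q hq => h q (by rw [mem_range] at hq; omega)

lemma cesSum_add {w w' : ℕ → ℝ} {c : ℝ} {N : ℕ} (h : ∀ q < N, w (N + q) = c * w' q) {m : ℕ}
    (hm : m ≤ N) :
    cesSum w (N + m) = cesSum w N + m * partSum w N + c * cesSum w' m := by
  unfold cesSum
  rw [sum_range_add, mul_sum, add_assoc]
  congr 1
  have : ∀ k ∈ range m, partSum w (N + k + 1) = partSum w N + c * partSum w' (k + 1) := by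
    intro k hk
    rw [mem_range] at hk
    rw [add_assoc, partSum_add h (by omega)]
  rw [sum_congr rfl this, sum_add_distrib]
  simp

section WalshLike

variable {w ρ : ℕ → ℝ} {A : ℕ}

lemma partSum_two_pow (h0 : w 0 = 1) (hw : ∀ a < A, ∀ q < 2 ^ a, w (2 ^ a + q) = ρ a * w q)
    {a : ℕ} (ha : a ≤ A) : partSum w (2 ^ a) = ∏ k ∈ range a, (1 + ρ k) := by
  induction a with
  | zero => simp [partSum, h0]
  | succ a ih =>
    have h2 : 2 ^ (a + 1) = 2 ^ a + 2 ^ a := by ring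
    rw [h2, partSum_add (hw a (by omega)) le_rfl, ih (by omega), prod_range_succ]
    ring

lemma cesSum_two_pow (h0 : w 0 = 1) (hw : ∀ a < A, ∀ q < 2 ^ a, w (2 ^ a + q) = ρ a * w q)
    {a : ℕ} (ha : a ≤ A) :
    cesSum w (2 ^ a) = ∏ k ∈ range a, (1 + ρ k)
      + ∑ j ∈ range a, 2 ^ j * ∏ k ∈ (range a).erase j, (1 + ρ k) := by
  induction a with
  | zero => simp [cesSum, partSum, h0]
  | succ a ih =>
    have h2 : 2 ^ (a + 1) = 2 ^ a + 2 ^ a := by ring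
    have h3 : ∀ j ∈ range a, (2 : ℝ) ^ j * ∏ k ∈ (range (a + 1)).erase j, (1 + ρ k)
        = (1 + ρ a) * (2 ^ j * ∏ k ∈ (range a).erase j, (1 + ρ k)) := by
      intro j hj
      rw [mem_range] at hj
      have h4 : (range (a + 1)).erase j = insert a ((range a).erase j) := by
        ext k; simp only [mem_erase, mem_range, mem_insert]; omega
      rw [h4, prod_insert (by simp)]
      ring
    have h5 : (range (a + 1)).erase a = range a := by
      ext k; simp only [mem_erase, mem_range]; omega
    rw [h2, cesSum_add (hw a (by omega)) le_rfl, ih (by omega),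
      partSum_two_pow h0 hw (by omega), prod_range_succ, sum_range_succ, sum_congr rfl h3,
      ← mul_sum, h5]
    push_cast
    ring

lemma abs_cesSum_le (h0 : w 0 = 1) (hw : ∀ a < A, ∀ q < 2 ^ a, w (2 ^ a + q) = ρ a * w q)
    (hρ : ∀ a, |ρ a| ≤ 1) {m : ℕ} (hm : m ≤ 2 ^ A) :
    |cesSum w m| ≤ 1 + ∑ a ∈ range A, ((2 ^ a + 1) * ∏ k ∈ range a, (1 + ρ k)
      + ∑ j ∈ range a, 2 ^ j * ∏ k ∈ (range a).erase j, (1 + ρ k)) := by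
  have hpos : ∀ S : Finset ℕ, 0 ≤ ∏ k ∈ S, (1 + ρ k) := fun S =>
    prod_nonneg fun k _ => by have := (abs_le.1 (hρ k)).1; linarith
  have hsum : ∀ a, 0 ≤ ∑ j ∈ range a, 2 ^ j * ∏ k ∈ (range a).erase j, (1 + ρ k) := fun a =>
    sum_nonneg fun j _ => mul_nonneg (by positivity) (hpos _)
  have key : ∀ b ≤ A, ∀ m ≤ 2 ^ b, |cesSum w m| ≤ 1 + ∑ a ∈ range b,
      ((2 ^ a + 1) * ∏ k ∈ range a, (1 + ρ k)
      + ∑ j ∈ range a, 2 ^ j * ∏ k ∈ (range a).erase j, (1 + ρ k)) := by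
    intro b
    induction b with
    | zero =>
      intro _ m hm
      have : m = 0 ∨ m = 1 := by rw [pow_zero] at hm; omega
      rcases this with rfl | rfl <;> simp [cesSum, partSum, h0]
    | succ b ih =>
      intro hb m hm
      rw [sum_range_succ]
      have hp := hpos (range b)
      have hs := hsum b
      by_cases hmb : m ≤ 2 ^ b
      · have := ih (by omega) m hmb
        have h1 : 0 ≤ (2 ^ b + 1) * ∏ k ∈ range b, (1 + ρ k) := by positivity
        linarith
      · obtain ⟨m', rfl⟩ : ∃ m', m = 2 ^ b + m' := ⟨m - 2 ^ b, by omega⟩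
        have hm' : m' ≤ 2 ^ b := by rw [pow_succ] at hm; omega
        rw [cesSum_add (hw b (by omega)) hm', cesSum_two_pow h0 hw (by omega),
          partSum_two_pow h0 hw (by omega)]
        have h1 := ih (by omega) m' hm'
        have h2 : |ρ b * cesSum w m'| ≤ |cesSum w m'| := by
          rw [abs_mul]
          exact mul_le_of_le_one_left (abs_nonneg _) (hρ b)
        have h3 : (m' : ℝ) * ∏ k ∈ range b, (1 + ρ k) ≤ 2 ^ b * ∏ k ∈ range b, (1 + ρ k) :=
          mul_le_mul_of_nonneg_right (by exact_mod_cast hm') hp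
        have h4 : 0 ≤ (m' : ℝ) * ∏ k ∈ range b, (1 + ρ k) := by positivity
        have h5 := abs_le.1 (h2.trans h1)
        rw [abs_le]
        constructor <;> linarith [h5.1, h5.2]
  exact key A le_rfl m hm

end WalshLike

/-- The Walsh functions in reversed coordinates, `w_q(τ_A z)` for `q < 2 ^ A`. -/
def revWalsh (A : ℕ) (z : WG) (q : ℕ) : ℝ :=
  ∏ k ∈ range A, if q.testBit k then rad (A - 1 - k) z else 1

lemma revWalsh_zero (A : ℕ) (z : WG) : revWalsh A z 0 = 1 := by simp [revWalsh]

lemma revWalsh_two_pow_add {A : ℕ} (z : WG) : ∀ a < A, ∀ q < 2 ^ a,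
    revWalsh A z (2 ^ a + q) = rad (A - 1 - a) z * revWalsh A z q := by
  intro a ha q hq
  unfold revWalsh
  rw [← mul_prod_erase _ _ (mem_range.2 ha), ← mul_prod_erase (range A)
    (fun k => if q.testBit k then rad (A - 1 - k) z else 1) (mem_range.2 ha),
    Nat.testBit_two_pow_add_eq, Nat.testBit_lt_two_pow hq]
  simp only [Bool.not_false, if_true, Bool.false_eq_true, if_false, one_mul]
  congr 1
  refine prod_congr rfl fun k hk => ?_
  rw [mem_erase] at hk
  rcases lt_or_gt_of_ne hk.1 with h | h
  · rw [Nat.testBit_two_pow_add_gt h]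
  · rw [Nat.testBit_lt_two_pow (hq.trans (Nat.pow_lt_pow_right one_lt_two h)),
      Nat.testBit_lt_two_pow (x := 2 ^ a + q)]
    have : 2 ^ (a + 1) ≤ 2 ^ k := Nat.pow_le_pow_right two_pos h
    rw [pow_succ] at this
    omega

lemma kacz_two_pow_add (A : ℕ) (z : WG) :
    ∀ q < 2 ^ A, kacz (2 ^ A + q) z = rad A z * revWalsh A z q := by
  intro q hq
  have hlog : Nat.log 2 (2 ^ A + q) = A :=
    Nat.log_eq_of_pow_le_of_lt_pow (by omega) (by rw [pow_succ]; omega)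
  have hne : 2 ^ A + q ≠ 0 := by positivity
  unfold kacz revWalsh
  rw [if_neg hne, hlog, ← prod_pow_eq_pow_sum]
  congr 1
  refine prod_congr rfl fun k hk => ?_
  rw [Nat.testBit_two_pow_add_gt (mem_range.1 hk)]
  unfold rad
  split_ifs <;> simp

lemma prod_reverse_rad {A a : ℕ} (ha : a ≤ A) (z : WG) :
    ∏ k ∈ range a, (1 + rad (A - 1 - k) z) = riesz (Ico (A - a) A) z := by
  refine prod_nbij' (fun k => A - 1 - k) (fun k => A - 1 - k) ?_ ?_ ?_ ?_ ?_ <;> intro k hk <;>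
    simp only [mem_range, mem_Ico] at * <;> omega

lemma prod_reverse_rad_erase {A a j : ℕ} (ha : a ≤ A) (hj : j < a) (z : WG) :
    ∏ k ∈ (range a).erase j, (1 + rad (A - 1 - k) z)
      = riesz ((Ico (A - a) A).erase (A - 1 - j)) z := by
  refine prod_nbij' (fun k => A - 1 - k) (fun k => A - 1 - k) ?_ ?_ ?_ ?_ ?_ <;> intro k hk <;>
    simp only [mem_range, mem_Ico, mem_erase] at * <;> omega

lemma abs_rad (k : ℕ) (z : WG) : |rad k z| = 1 := by
  rcases rad_eq k z with ⟨_, h⟩ | ⟨_, h⟩ <;> rw [h] <;> norm_num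

lemma abs_cesSum_revWalsh_le {A m : ℕ} (hm : m ≤ 2 ^ A) (z : WG) :
    |cesSum (revWalsh A z) m| ≤ 1 + ∑ a ∈ range A, ((2 ^ a + 1) * riesz (Ico (A - a) A) z
      + ∑ j ∈ range a, 2 ^ j * riesz ((Ico (A - a) A).erase (A - 1 - j)) z) := by
  refine (abs_cesSum_le (revWalsh_zero A z) (revWalsh_two_pow_add z)
    (fun a => (abs_rad _ z).le) hm).trans_eq ?_
  congr 1
  refine sum_congr rfl fun a ha => ?_
  rw [mem_range] at ha
  rw [prod_reverse_rad ha.le]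
  congr 1
  refine sum_congr rfl fun j hj => ?_
  rw [prod_reverse_rad_erase ha.le (mem_range.1 hj)]

/-- The sum of weighted Riesz products dominating the Kaczmarz kernels of order `i`. -/
def kaczMaj (i : ℕ) (z : WG) : ℝ :=
  ∑ s ∈ range (i + 1), ∑ t ∈ range (i + 1), (3 / 4 : ℝ) ^ (s + t) * riesz ((Ico s i).erase t) z

lemma kaczMaj_term_nonneg (i s t : ℕ) (z : WG) :
    0 ≤ (3 / 4 : ℝ) ^ (s + t) * riesz ((Ico s i).erase t) z :=
  mul_nonneg (by positivity) (riesz_nonneg _ _)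

lemma kaczMaj_term_le {i s t : ℕ} (hs : s ≤ i) (ht : t ≤ i) (z : WG) :
    (3 / 4 : ℝ) ^ (s + t) * riesz ((Ico s i).erase t) z ≤ kaczMaj i z := by
  unfold kaczMaj
  refine (single_le_sum (f := fun t => (3 / 4 : ℝ) ^ (s + t) * riesz ((Ico s i).erase t) z)
    (fun t _ => kaczMaj_term_nonneg i s t z) (mem_range.2 (by omega : t < i + 1))).trans ?_
  exact single_le_sum (f := fun s => ∑ t ∈ range (i + 1),
    (3 / 4 : ℝ) ^ (s + t) * riesz ((Ico s i).erase t) z)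
    (fun s _ => sum_nonneg fun t _ => kaczMaj_term_nonneg i s t z)
    (mem_range.2 (by omega : s < i + 1))

lemma one_le_two_pow_mul_kaczMaj (i : ℕ) (z : WG) : 1 ≤ 2 ^ i * kaczMaj i z := by
  have h := kaczMaj_term_le (le_refl i) (le_refl i) z
  simp only [Ico_self, erase_empty, riesz, prod_empty, mul_one] at h
  calc (1 : ℝ) ≤ (9 / 8) ^ i := one_le_pow₀ (by norm_num)
    _ = 2 ^ i * (3 / 4) ^ (i + i) := by
      rw [← two_mul i, pow_mul, ← mul_pow]; norm_num
    _ ≤ 2 ^ i * kaczMaj i z := by gcongr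

lemma riesz_range_le_kaczMaj (i : ℕ) (z : WG) : riesz (range i) z ≤ 2 * kaczMaj i z := by
  have h := kaczMaj_term_le (Nat.zero_le i) (Nat.zero_le i) z
  have h2 := riesz_le_two_mul_riesz_erase (range i) 0 z
  rw [range_eq_Ico] at *
  simp only [add_zero, pow_zero, one_mul] at h
  linarith

lemma half_pow_le (s t : ℕ) (h : s ≤ t) : (1 / 2 : ℝ) ^ t ≤ (3 / 4) ^ (s + t) := by
  calc (1 / 2 : ℝ) ^ t ≤ (9 / 16) ^ t := pow_le_pow_left₀ (by norm_num) (by norm_num) t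
    _ = (3 / 4) ^ (t + t) := by rw [← two_mul, pow_mul]; norm_num
    _ ≤ (3 / 4) ^ (s + t) := pow_le_pow_of_le_one (by norm_num) (by norm_num) (by omega)

lemma sum_riesz_Ico_le (i : ℕ) (z : WG) :
    ∑ a ∈ range i, (2 ^ a + 1) * riesz (Ico (i - a) i) z ≤ 4 * (2 ^ i * kaczMaj i z) := by
  have h1 : ∀ a ∈ range i, (2 ^ a + 1) * riesz (Ico (i - a) i) z
      ≤ 4 * (2 ^ i * ((3 / 4 : ℝ) ^ ((i - a) + (i - a)) * riesz ((Ico (i - a) i).erase (i - a)) z))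
      := by
    intro a ha
    rw [mem_range] at ha
    have hr := riesz_le_two_mul_riesz_erase (Ico (i - a) i) (i - a) z
    have hn := riesz_nonneg ((Ico (i - a) i).erase (i - a)) z
    have h3 : (2 : ℝ) ^ a = 2 ^ i * (1 / 2) ^ (i - a) := by
      conv_rhs => rw [show i = a + (i - a) by omega, pow_add, Nat.add_sub_cancel_left]
      rw [mul_assoc, ← mul_pow]; norm_num
    have h4 := half_pow_le (i - a) (i - a) le_rfl
    have h5 : (1 : ℝ) ≤ 2 ^ a := one_le_pow₀ (by norm_num)
    calc (2 ^ a + 1) * riesz (Ico (i - a) i) z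
        ≤ (2 * 2 ^ a) * (2 * riesz ((Ico (i - a) i).erase (i - a)) z) := by
          gcongr
          · exact riesz_nonneg _ _
          · linarith
      _ = 4 * (2 ^ i * ((1 / 2) ^ (i - a) * riesz ((Ico (i - a) i).erase (i - a)) z)) := by
          rw [h3]; ring
      _ ≤ _ := by gcongr
  refine (sum_le_sum h1).trans ?_
  rw [← mul_sum, ← mul_sum]
  gcongr
  unfold kaczMaj
  rw [← sum_range_reflect, sum_range_succ' (fun s => ∑ t ∈ range (i + 1), _)]
  refine le_trans ?_ (le_add_of_nonneg_right
    (sum_nonneg fun t _ => kaczMaj_term_nonneg i 0 t z))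
  refine sum_le_sum fun b hb => ?_
  rw [mem_range] at hb
  have : i - (i - 1 - b) = b + 1 := by omega
  rw [this]
  exact single_le_sum (f := fun t => (3 / 4 : ℝ) ^ (b + 1 + t) * riesz ((Ico (b + 1) i).erase t) z)
    (fun t _ => kaczMaj_term_nonneg i _ t z) (mem_range.2 (by omega : b + 1 < i + 1))

lemma sum_sum_riesz_erase_le (i : ℕ) (z : WG) :
    ∑ a ∈ range i, ∑ j ∈ range a, 2 ^ j * riesz ((Ico (i - a) i).erase (i - 1 - j)) z
      ≤ 2 ^ i * kaczMaj i z := by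
  have h1 : ∀ a ∈ range i, ∑ j ∈ range a, 2 ^ j * riesz ((Ico (i - a) i).erase (i - 1 - j)) z
      ≤ 2 ^ i * ∑ j ∈ range i, (3 / 4 : ℝ) ^ ((i - a) + (i - 1 - j)) *
        riesz ((Ico (i - a) i).erase (i - 1 - j)) z := by
    intro a ha
    rw [mem_range] at ha
    rw [mul_sum]
    refine le_trans (sum_le_sum ?_) (sum_le_sum_of_subset_of_nonneg
      (range_subset_range.2 ha.le) fun j _ _ => mul_nonneg (by positivity)
        (kaczMaj_term_nonneg i _ _ z))
    intro j hj
    rw [mem_range] at hj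
    rw [← mul_assoc]
    refine mul_le_mul_of_nonneg_right ?_ (riesz_nonneg _ _)
    have h4 := half_pow_le (i - a) (i - 1 - j) (by omega)
    have h3 : (2 : ℝ) ^ j ≤ 2 ^ i * (1 / 2) ^ (i - 1 - j) := by
      conv_rhs => rw [show i = j + 1 + (i - 1 - j) by omega, pow_add,
        show j + 1 + (i - 1 - j) - 1 - j = i - 1 - j by omega]
      rw [mul_assoc, ← mul_pow, pow_succ]
      norm_num
    refine h3.trans ?_
    gcongr
  refine (sum_le_sum h1).trans ?_
  rw [← mul_sum]
  gcongr
  unfold kaczMaj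
  rw [← sum_range_reflect, sum_range_succ' (fun s => ∑ t ∈ range (i + 1), _)]
  refine le_trans ?_ (le_add_of_nonneg_right
    (sum_nonneg fun t _ => kaczMaj_term_nonneg i 0 t z))
  refine sum_le_sum fun b hb => ?_
  rw [mem_range] at hb
  have : i - (i - 1 - b) = b + 1 := by omega
  rw [this, ← sum_range_reflect, sum_range_succ]
  refine le_trans (le_of_eq ?_) (le_add_of_nonneg_right (kaczMaj_term_nonneg i _ i z))
  refine sum_congr rfl fun j hj => ?_
  rw [mem_range] at hj
  have : i - 1 - (i - 1 - j) = j := by omega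
  rw [this]

lemma abs_cesSum_revWalsh_le_kaczMaj {i m : ℕ} (hm : m ≤ 2 ^ i) (z : WG) :
    |cesSum (revWalsh i z) m| ≤ 6 * (2 ^ i * kaczMaj i z) := by
  have h1 := abs_cesSum_revWalsh_le hm z
  rw [sum_add_distrib] at h1
  linarith [sum_riesz_Ico_le i z, sum_sum_riesz_erase_le i z, one_le_two_pow_mul_kaczMaj i z]

lemma kacz_zero (z : WG) : kacz 0 z = 1 := by simp [kacz]

lemma dirK_two_pow (A : ℕ) (z : WG) : dirK (2 ^ A) z = riesz (range A) z := by
  change partSum (fun k => kacz k z) (2 ^ A) = _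
  induction A with
  | zero => simp [partSum, kacz_zero, riesz]
  | succ A ih =>
    have h2 : 2 ^ (A + 1) = 2 ^ A + 2 ^ A := by ring
    have h3 := partSum_two_pow (revWalsh_zero A z) (revWalsh_two_pow_add z) le_rfl
    rw [prod_reverse_rad le_rfl, Nat.sub_self, ← range_eq_Ico] at h3
    rw [h2, partSum_add (kacz_two_pow_add A z) le_rfl, ih, h3]
    unfold riesz
    rw [prod_range_succ]
    ring

lemma abs_cesSum_kacz_le {A n : ℕ} (hn : n ≤ 2 ^ (A + 1)) (z : WG) :
    |cesSum (fun k => kacz k z) n| ≤ 9 * ∑ i ∈ range (A + 1), 2 ^ i * kaczMaj i z := by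
  have key : ∀ B n, n ≤ 2 ^ B → |cesSum (fun k => kacz k z) n|
      ≤ 1 + 8 * ∑ i ∈ range B, 2 ^ i * kaczMaj i z := by
    intro B
    induction B with
    | zero =>
      intro n hn
      have : n = 0 ∨ n = 1 := by rw [pow_zero] at hn; omega
      rcases this with rfl | rfl <;> simp [cesSum, partSum, kacz_zero]
    | succ B ih =>
      intro n hn
      rw [sum_range_succ]
      have hB := one_le_two_pow_mul_kaczMaj B z
      by_cases hnB : n ≤ 2 ^ B
      · have := ih n hnB
        linarith
      · obtain ⟨m, rfl⟩ : ∃ m, n = 2 ^ B + m := ⟨n - 2 ^ B, by omega⟩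
        have hm : m ≤ 2 ^ B := by rw [pow_succ] at hn; omega
        have hD : partSum (fun k => kacz k z) (2 ^ B) = riesz (range B) z := dirK_two_pow B z
        rw [cesSum_add (kacz_two_pow_add B z) hm, hD]
        have h1 := ih (2 ^ B) le_rfl
        have h2 := abs_cesSum_revWalsh_le_kaczMaj hm z
        have h3 : (m : ℝ) * riesz (range B) z ≤ 2 * (2 ^ B * kaczMaj B z) := by
          calc (m : ℝ) * riesz (range B) z ≤ 2 ^ B * (2 * kaczMaj B z) :=
                mul_le_mul (by exact_mod_cast hm) (riesz_range_le_kaczMaj B z)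
                  (riesz_nonneg _ _) (by positivity)
            _ = _ := by ring
        have h4 : 0 ≤ (m : ℝ) * riesz (range B) z := mul_nonneg (by positivity) (riesz_nonneg _ _)
        calc _ ≤ |cesSum (fun k => kacz k z) (2 ^ B) + m * riesz (range B) z|
                + |rad B z * cesSum (revWalsh B z) m| := abs_add_le _ _
          _ ≤ |cesSum (fun k => kacz k z) (2 ^ B)| + |m * riesz (range B) z|
                + |rad B z * cesSum (revWalsh B z) m| := by gcongr; exact abs_add_le _ _
          _ ≤ _ := by
            rw [abs_mul (rad B z), abs_rad, one_mul, abs_of_nonneg h4]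
            linarith
  have h1 := key (A + 1) n hn
  have h2 : 1 ≤ ∑ i ∈ range (A + 1), 2 ^ i * kaczMaj i z := by
    rw [sum_range_succ]
    have := one_le_two_pow_mul_kaczMaj A z
    have : 0 ≤ ∑ i ∈ range A, 2 ^ i * kaczMaj i z := sum_nonneg fun i _ => by
      linarith [one_le_two_pow_mul_kaczMaj i z]
    linarith
  linarith

/-- The one-dimensional Walsh–Kaczmarz–Fejér kernel. -/
def fejerKer (n : ℕ) (z : WG) : ℝ := (n : ℝ)⁻¹ * ∑ k ∈ Icc 1 n, dirK k z

/-- Index set of the Riesz products dominating the Fejér kernels of order at most `A`. -/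
def rieszIdx (A : ℕ) : Finset (ℕ × ℕ × ℕ) := range (A + 1) ×ˢ range (A + 1) ×ˢ range (A + 1)

lemma abs_fejerKer_le {A n : ℕ} (hn : 2 ^ A ≤ n) (hn' : n ≤ 2 ^ (A + 1)) (z : WG) :
    |fejerKer n z| ≤ 9 * ∑ p ∈ rieszIdx A, (1 / 2 : ℝ) ^ (A - p.1) *
      ((3 / 4 : ℝ) ^ (p.2.1 + p.2.2) * riesz ((Ico p.2.1 p.1).erase p.2.2) z) := by
  have hn0 : (0 : ℝ) < n := by exact_mod_cast (pow_pos two_pos A).trans_le hn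
  have h1 : ∑ k ∈ Icc 1 n, dirK k z = cesSum (fun k => kacz k z) n := by
    unfold cesSum
    rw [range_eq_Ico, Finset.sum_Ico_add' (fun k => partSum (fun k => kacz k z) k)]
    rfl
  unfold fejerKer
  rw [h1, abs_mul, abs_of_pos (inv_pos.2 hn0), inv_mul_le_iff₀ hn0]
  refine (abs_cesSum_kacz_le hn' z).trans ?_
  rw [mul_left_comm]
  gcongr
  unfold rieszIdx
  rw [sum_product, mul_sum]
  refine sum_le_sum fun i hi => ?_
  rw [mem_range] at hi
  rw [sum_product]
  simp only [← mul_sum]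
  rw [← mul_assoc]
  have h3 : (2 : ℝ) ^ i = 2 ^ A * (1 / 2) ^ (A - i) := by
    conv_rhs => rw [show A = i + (A - i) by omega, pow_add, Nat.add_sub_cancel_left]
    rw [mul_assoc, ← mul_pow]; norm_num
  have h4 : kaczMaj i z ≤ ∑ s ∈ range (A + 1), ∑ t ∈ range (A + 1),
      (3 / 4 : ℝ) ^ (s + t) * riesz ((Ico s i).erase t) z := by
    unfold kaczMaj
    have hsub : range (i + 1) ⊆ range (A + 1) := range_subset_range.2 hi
    refine (sum_le_sum fun s _ => sum_le_sum_of_subset_of_nonneg hsub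
      fun t _ _ => kaczMaj_term_nonneg i s t z).trans ?_
    exact sum_le_sum_of_subset_of_nonneg hsub
      fun s _ _ => sum_nonneg fun t _ => kaczMaj_term_nonneg i s t z
  refine mul_le_mul ?_ h4 (sum_nonneg fun s _ => sum_nonneg fun t _ => kaczMaj_term_nonneg i s t z)
    (by positivity)
  rw [h3]
  gcongr
  exact_mod_cast hn

lemma kacz_eq_rad_mul_revWalsh {m : ℕ} (hm : m ≠ 0) :
    ∃ q, ∀ z, kacz m z = rad (Nat.log 2 m) z * revWalsh (Nat.log 2 m) z q := by
  refine ⟨m - 2 ^ Nat.log 2 m, fun z => ?_⟩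
  have h1 := Nat.pow_log_le_self 2 hm
  have h2 := Nat.lt_pow_succ_log_self one_lt_two m
  rw [← kacz_two_pow_add, Nat.add_sub_cancel' h1]
  rw [pow_succ] at h2
  omega

lemma revWalsh_add (A : ℕ) (x y : WG) (q : ℕ) :
    revWalsh A (x + y) q = revWalsh A x q * revWalsh A y q := by
  unfold revWalsh
  rw [← prod_mul_distrib]
  refine prod_congr rfl fun k _ => ?_
  split_ifs
  · exact rad_add _ _ _
  · simp

lemma kacz_add (m : ℕ) (x y : WG) : kacz m (x + y) = kacz m x * kacz m y := by
  by_cases hm : m = 0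
  · simp [hm, kacz_zero]
  · obtain ⟨q, h⟩ := kacz_eq_rad_mul_revWalsh hm
    rw [h, h, h, rad_add, revWalsh_add]
    ring

lemma continuous_kacz (m : ℕ) : Continuous (kacz m) := by
  by_cases hm : m = 0
  · rw [show kacz m = fun _ => 1 from funext fun z => by rw [hm, kacz_zero]]
    exact continuous_const
  · obtain ⟨q, h⟩ := kacz_eq_rad_mul_revWalsh hm
    rw [show kacz m = _ from funext h]
    refine (continuous_rad _).mul (continuous_finsetProd _ fun k _ => ?_)
    split_ifs
    · exact continuous_rad _
    · exact continuous_const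

lemma kacz_single_log {m : ℕ} (hm : m ≠ 0) :
    kacz m (Pi.single (Nat.log 2 m) 1 : WG) = -1 := by
  obtain ⟨q, h⟩ := kacz_eq_rad_mul_revWalsh hm
  rw [h, rad_single, if_pos rfl]
  have : revWalsh (Nat.log 2 m) (Pi.single (Nat.log 2 m) 1 : WG) q = 1 := by
    refine prod_eq_one fun k hk => ?_
    rw [mem_range] at hk
    have hne : Nat.log 2 m - 1 - k ≠ Nat.log 2 m := by omega
    simp [rad_single, hne]
  rw [this, mul_one]

lemma continuous_dirK (n : ℕ) : Continuous (dirK n) :=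
  continuous_finsetSum _ fun k _ => continuous_kacz k

lemma integrable_mul_comp_add {f : (Fin 2 → WG) → ℝ} (hf : Integrable f (μD 2))
    {φ : (Fin 2 → WG) → ℝ} (hφ : Continuous φ) (x : Fin 2 → WG) :
    Integrable (fun y => f y * φ (x + y)) (μD 2) := by
  have hc : Continuous fun y => φ (x + y) := hφ.comp (continuous_const_add x)
  obtain ⟨C, hC⟩ := isCompact_univ.exists_bound_of_continuousOn hc.continuousOn
  exact hf.mul_bdd hc.aestronglyMeasurable (ae_of_all _ fun y => hC y (Set.mem_univ _))

/-- The tensor product of two functions on the Walsh group. -/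
def tensor (φ ψ : WG → ℝ) (z : Fin 2 → WG) : ℝ := φ (z 0) * ψ (z 1)

lemma continuous_tensor {φ ψ : WG → ℝ} (hφ : Continuous φ) (hψ : Continuous ψ) :
    Continuous (tensor φ ψ) :=
  (hφ.comp (continuous_apply 0)).mul (hψ.comp (continuous_apply 1))

lemma kaczD_add (m : Fin 2 → ℕ) (x y : Fin 2 → WG) :
    kaczD 2 m (x + y) = kaczD 2 m x * kaczD 2 m y := by
  unfold kaczD
  rw [← prod_mul_distrib]
  exact prod_congr rfl fun i _ => kacz_add _ _ _

lemma continuous_kaczD (m : Fin 2 → ℕ) : Continuous (kaczD 2 m) :=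
  continuous_finsetProd _ fun i _ => (continuous_kacz (m i)).comp (continuous_apply i)

lemma partialSumOf_eq_integral {f : (Fin 2 → WG) → ℝ} (hf : Integrable f (μD 2))
    (k : Fin 2 → ℕ) (x : Fin 2 → WG) :
    partialSumOf 2 (fCoeff 2 f) k x
      = ∫ y, f y * tensor (dirK (k 0)) (dirK (k 1)) (x + y) ∂μD 2 := by
  have h1 : ∀ m : Fin 2 → ℕ, fCoeff 2 f m * kaczD 2 m x
      = ∫ y, f y * kaczD 2 m (x + y) ∂μD 2 := by
    intro m
    unfold fCoeff
    rw [← integral_mul_const]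
    congr 1 with y
    rw [kaczD_add]
    ring
  unfold partialSumOf
  simp_rw [h1]
  rw [← integral_finsetSum _ fun m _ => integrable_mul_comp_add hf (continuous_kaczD m) x]
  congr 1 with y
  rw [← mul_sum]
  congr 1
  have h2 := prod_univ_sum (fun i => range (k i)) (fun i j => kacz j ((x + y) i))
  unfold kaczD
  rw [← h2, Fin.prod_univ_two]
  rfl

lemma fejer2_eq_integral {f : (Fin 2 → WG) → ℝ} (hf : Integrable f (μD 2))
    (n : Fin 2 → ℕ) (x : Fin 2 → WG) :
    fejer2 f n x = ∫ y, f y * tensor (fejerKer (n 0)) (fejerKer (n 1)) (x + y) ∂μD 2 := by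
  have hc : ∀ k₁ k₂, Continuous (tensor (dirK k₁) (dirK k₂)) := fun k₁ k₂ =>
    continuous_tensor (continuous_dirK k₁) (continuous_dirK k₂)
  unfold fejer2
  simp_rw [partialSumOf_eq_integral hf]
  simp only [if_true, one_ne_zero, if_false]
  simp_rw [← integral_finsetSum _ fun k₂ (_ : k₂ ∈ Icc 1 (n 1)) =>
    integrable_mul_comp_add hf (hc _ k₂) x]
  rw [← integral_finsetSum _ fun k₁ _ => integrable_finsetSum _ fun k₂ _ =>
    integrable_mul_comp_add hf (hc k₁ k₂) x, ← integral_const_mul]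
  congr 1 with y
  simp only [← mul_sum]
  rw [mul_left_comm]
  congr 1
  unfold tensor fejerKer
  rw [mul_mul_mul_comm, ← mul_inv, sum_mul_sum]

lemma fejer2_sub {f g : (Fin 2 → WG) → ℝ} (hf : Integrable f (μD 2)) (hg : Integrable g (μD 2))
    (n : Fin 2 → ℕ) (x : Fin 2 → WG) :
    fejer2 (f - g) n x = fejer2 f n x - fejer2 g n x := by
  have hdK : ∀ n, Continuous (fejerKer n) := fun n =>
    continuous_const.mul (continuous_finsetSum _ fun k _ => continuous_dirK k)
  have hc := continuous_tensor (hdK (n 0)) (hdK (n 1))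
  rw [fejer2_eq_integral hf, fejer2_eq_integral hg, fejer2_eq_integral (hf.sub hg),
    ← integral_sub (integrable_mul_comp_add hf hc x) (integrable_mul_comp_add hg hc x)]
  congr 1 with y
  rw [Pi.sub_apply]
  ring

/-- Coordinates of the Riesz product with index `p = (i, s, t)`. -/
def rieszSet (p : ℕ × ℕ × ℕ) : Finset ℕ := (Ico p.2.1 p.1).erase p.2.2

/-- Weight of the Riesz product with index `p` in the bound for kernels of order `A`. -/
def rieszWt (A : ℕ) (p : ℕ × ℕ × ℕ) : ℝ := (1 / 2) ^ (A - p.1) * (3 / 4) ^ (p.2.1 + p.2.2)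

lemma rieszWt_nonneg (A : ℕ) (p : ℕ × ℕ × ℕ) : 0 ≤ rieszWt A p := by
  unfold rieszWt; positivity

lemma enorm_fejer2_le {f : (Fin 2 → WG) → ℝ} (hf : Integrable f (μD 2)) (hfm : Measurable f)
    {A A' : ℕ} {n : Fin 2 → ℕ} (h0 : 2 ^ A ≤ n 0) (h0' : n 0 ≤ 2 ^ (A + 1))
    (h1 : 2 ^ A' ≤ n 1) (h1' : n 1 ≤ 2 ^ (A' + 1)) (x : Fin 2 → WG) :
    ‖fejer2 f n x‖ₑ ≤ ∑ p ∈ rieszIdx A, ∑ p' ∈ rieszIdx A',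
      ENNReal.ofReal (81 * (rieszWt A p * rieszWt A' p')) *
        avgOff (rieszSet p) (rieszSet p') (fun y => ‖f y‖ₑ) x := by
  have hP : ∀ S T, Measurable fun y => ENNReal.ofReal (riesz₂ S T (x + y)) := fun S T =>
    ((continuous_riesz₂ S T).comp (continuous_const_add x)).measurable.ennreal_ofReal
  have hm : ∀ p p', Measurable fun y => ‖f y‖ₑ *
      ENNReal.ofReal (riesz₂ (rieszSet p) (rieszSet p') (x + y)) := fun p p' =>
    hfm.enorm.mul (hP _ _)
  rw [fejer2_eq_integral hf]
  refine (enorm_integral_le_lintegral_enorm _).trans ?_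
  unfold avgOff
  simp_rw [← lintegral_const_mul _ (hm _ _)]
  simp_rw [← lintegral_finsetSum (rieszIdx A') fun p' _ => (hm _ p').const_mul _]
  rw [← lintegral_finsetSum _ fun p _ =>
    Finset.measurable_fun_sum _ fun p' _ => (hm p p').const_mul _]
  refine lintegral_mono fun y => ?_
  rw [enorm_mul]
  simp_rw [mul_left_comm _ ‖f y‖ₑ]
  simp_rw [← mul_sum]
  gcongr
  have hpos : ∀ p p', 0 ≤ 81 * (rieszWt A p * rieszWt A' p') := fun p p' =>
    mul_nonneg (by norm_num) (mul_nonneg (rieszWt_nonneg _ _) (rieszWt_nonneg _ _))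
  simp_rw [← ENNReal.ofReal_mul (hpos _ _)]
  simp_rw [← ENNReal.ofReal_sum_of_nonneg fun p' (_ : p' ∈ rieszIdx A') =>
    mul_nonneg (hpos _ p') (riesz₂_nonneg _ _ _)]
  rw [← ENNReal.ofReal_sum_of_nonneg fun p _ => sum_nonneg fun p' _ =>
    mul_nonneg (hpos p p') (riesz₂_nonneg _ _ _), Real.enorm_eq_ofReal_abs]
  refine ENNReal.ofReal_le_ofReal ?_
  unfold tensor
  rw [abs_mul]
  refine (mul_le_mul (abs_fejerKer_le h0 h0' _) (abs_fejerKer_le h1 h1' _) (abs_nonneg _)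
    (mul_nonneg (by norm_num) (sum_nonneg fun p _ => mul_nonneg (by positivity)
      (mul_nonneg (by positivity) (riesz_nonneg _ _))))).trans_eq ?_
  rw [mul_mul_mul_comm, sum_mul_sum, mul_sum]
  refine sum_congr rfl fun p _ => ?_
  rw [mul_sum]
  refine sum_congr rfl fun p' _ => ?_
  unfold rieszWt riesz₂ rieszSet
  ring

/-- Exponent of the level in the definition of the exceptional set. -/
def lvlExp (p p' : ℕ × ℕ × ℕ) : ℕ :=
  ((p.1 - p'.1) + (p'.1 - p.1)) + (p.2.1 + p.2.2) + (p'.2.1 + p'.2.2)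

/-- The set where some average of `g` exceeds its level. -/
def excSet (g : (Fin 2 → WG) → ℝ≥0∞) (ε : ℝ) : Set (Fin 2 → WG) :=
  {x | ∃ p p', ENNReal.ofReal (ε * (8 / 7) ^ lvlExp p p') <
    avgOff (rieszSet p) (rieszSet p') g x}

lemma sum_geom_le {r : ℝ} (h0 : 0 ≤ r) (h1 : r < 1) (n : ℕ) :
    ∑ i ∈ range n, r ^ i ≤ (1 - r)⁻¹ := by
  rw [← tsum_geometric_of_lt_one h0 h1]
  exact (summable_geometric_of_lt_one h0 h1).sum_le_tsum _ fun i _ => pow_nonneg h0 i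

lemma sum_rieszIdx_le (A : ℕ) :
    ∑ p ∈ rieszIdx A, (4 / 7 : ℝ) ^ (A - p.1) * (6 / 7) ^ (p.2.1 + p.2.2) ≤ 147 := by
  unfold rieszIdx
  rw [sum_product]
  simp_rw [sum_product, ← mul_sum, pow_add, ← mul_sum, ← sum_mul]
  have h1 : ∑ i ∈ range (A + 1), (4 / 7 : ℝ) ^ (A - i) ≤ 3 := by
    have := sum_range_reflect (fun i => (4 / 7 : ℝ) ^ i) (A + 1)
    simp only [Nat.add_sub_cancel] at this
    rw [this]
    exact (sum_geom_le (by norm_num) (by norm_num) _).trans (by norm_num)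
  have h2 : ∑ i ∈ range (A + 1), (6 / 7 : ℝ) ^ i ≤ 7 :=
    (sum_geom_le (by norm_num) (by norm_num) _).trans (by norm_num)
  have h3 : 0 ≤ ∑ i ∈ range (A + 1), (6 / 7 : ℝ) ^ i := sum_nonneg fun i _ => by positivity
  calc _ ≤ (3 : ℝ) * (7 * 7) := by gcongr
    _ = 147 := by norm_num

lemma abs_fejer2_le_of_notMem_excSet {f : (Fin 2 → WG) → ℝ} (hf : Integrable f (μD 2))
    (hfm : Measurable f) {A A' c : ℕ} {n : Fin 2 → ℕ} (h0 : 2 ^ A ≤ n 0) (h0' : n 0 ≤ 2 ^ (A + 1))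
    (h1 : 2 ^ A' ≤ n 1) (h1' : n 1 ≤ 2 ^ (A' + 1)) (hA : A ≤ A' + c) (hA' : A' ≤ A + c)
    {ε : ℝ} (hε : 0 ≤ ε) {x : Fin 2 → WG} (hx : x ∉ excSet (fun y => ‖f y‖ₑ) ε) :
    |fejer2 f n x| ≤ 81 * (8 / 7) ^ c * 147 ^ 2 * ε := by
  have hx' : ∀ p p', avgOff (rieszSet p) (rieszSet p') (fun y => ‖f y‖ₑ) x ≤
      ENNReal.ofReal (ε * (8 / 7) ^ lvlExp p p') := by
    intro p p'
    by_contra h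
    exact hx ⟨p, p', not_le.1 h⟩
  have hpos : ∀ p p', 0 ≤ 81 * (rieszWt A p * rieszWt A' p') := fun p p' =>
    mul_nonneg (by norm_num) (mul_nonneg (rieszWt_nonneg _ _) (rieszWt_nonneg _ _))
  have hlvl : ∀ p p', 0 ≤ ε * (8 / 7 : ℝ) ^ lvlExp p p' := fun p p' => by positivity
  set v : ℕ → ℕ × ℕ × ℕ → ℝ := fun A p => (4 / 7 : ℝ) ^ (A - p.1) * (6 / 7) ^ (p.2.1 + p.2.2)
  have hterm : ∀ p ∈ rieszIdx A, ∀ p' ∈ rieszIdx A',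
      81 * (rieszWt A p * rieszWt A' p') * (ε * (8 / 7) ^ lvlExp p p')
        ≤ 81 * (8 / 7) ^ c * ε * (v A p * v A' p') := by
    intro p hp p' hp'
    simp only [rieszIdx, mem_product, mem_range] at hp hp'
    have hle : lvlExp p p' ≤ c + ((A - p.1) + (p.2.1 + p.2.2))
        + ((A' - p'.1) + (p'.2.1 + p'.2.2)) := by
      unfold lvlExp; omega
    have hpow : (8 / 7 : ℝ) ^ lvlExp p p' ≤ (8 / 7) ^ (c + ((A - p.1) + (p.2.1 + p.2.2))
        + ((A' - p'.1) + (p'.2.1 + p'.2.2))) := pow_le_pow_right₀ (by norm_num) hle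
    have hv : ∀ A p, v A p = rieszWt A p * (8 / 7) ^ ((A - p.1) + (p.2.1 + p.2.2)) := by
      intro A p
      have e1 : (4 / 7 : ℝ) = 1 / 2 * (8 / 7) := by norm_num
      have e2 : (6 / 7 : ℝ) = 3 / 4 * (8 / 7) := by norm_num
      simp only [v, rieszWt]
      rw [e1, e2, mul_pow, mul_pow, pow_add (8 / 7 : ℝ)]
      ring
    calc _ ≤ 81 * (rieszWt A p * rieszWt A' p') * (ε * (8 / 7) ^ (c +
          ((A - p.1) + (p.2.1 + p.2.2)) + ((A' - p'.1) + (p'.2.1 + p'.2.2)))) :=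
          mul_le_mul_of_nonneg_left (mul_le_mul_of_nonneg_left hpow hε) (hpos p p')
      _ = _ := by
        rw [hv, hv, pow_add, pow_add (8 / 7 : ℝ) c]
        ring
  have hmain : ‖fejer2 f n x‖ₑ ≤ ENNReal.ofReal (81 * (8 / 7) ^ c * 147 ^ 2 * ε) := by
    refine (enorm_fejer2_le hf hfm h0 h0' h1 h1' x).trans ?_
    calc _ ≤ ∑ p ∈ rieszIdx A, ∑ p' ∈ rieszIdx A',
          ENNReal.ofReal (81 * (rieszWt A p * rieszWt A' p') * (ε * (8 / 7) ^ lvlExp p p')) := by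
          refine sum_le_sum fun p _ => sum_le_sum fun p' _ => ?_
          rw [ENNReal.ofReal_mul (hpos p p')]
          gcongr
          exact hx' p p'
      _ = ENNReal.ofReal (∑ p ∈ rieszIdx A, ∑ p' ∈ rieszIdx A',
          81 * (rieszWt A p * rieszWt A' p') * (ε * (8 / 7) ^ lvlExp p p')) := by
          rw [ENNReal.ofReal_sum_of_nonneg fun p _ => sum_nonneg fun p' _ =>
            mul_nonneg (hpos p p') (hlvl p p')]
          refine sum_congr rfl fun p _ => ?_
          rw [ENNReal.ofReal_sum_of_nonneg fun p' _ => mul_nonneg (hpos p p') (hlvl p p')]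
      _ ≤ _ := by
          refine ENNReal.ofReal_le_ofReal ?_
          calc _ ≤ ∑ p ∈ rieszIdx A, ∑ p' ∈ rieszIdx A',
                81 * (8 / 7) ^ c * ε * (v A p * v A' p') :=
                sum_le_sum fun p hp => sum_le_sum fun p' hp' => hterm p hp p' hp'
            _ = 81 * (8 / 7) ^ c * ε *
                ((∑ p ∈ rieszIdx A, v A p) * ∑ p' ∈ rieszIdx A', v A' p') := by
                simp_rw [← mul_sum]
                rw [sum_mul]
            _ ≤ 81 * (8 / 7) ^ c * ε * (147 * 147) := by
                gcongr
                · exact sum_rieszIdx_le A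
                · exact sum_rieszIdx_le A'
            _ = _ := by ring
  rw [Real.enorm_eq_ofReal_abs] at hmain
  exact (ENNReal.ofReal_le_ofReal_iff (by positivity)).1 hmain

lemma exists_measure_excSet_le : ∃ C : ℝ≥0∞, C ≠ ∞ ∧ ∀ {g : (Fin 2 → WG) → ℝ≥0∞},
    Measurable g → ∀ {ε : ℝ}, 0 < ε →
      μD 2 (excSet g ε) ≤ C * ((ENNReal.ofReal ε)⁻¹ * ∫⁻ x, g x ∂μD 2) := by
  set r : ℝ≥0∞ := ENNReal.ofReal (7 / 8)
  have hr : r < 1 := by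
    rw [← ENNReal.ofReal_one]
    exact (ENNReal.ofReal_lt_ofReal_iff one_pos).2 (by norm_num)
  have hfin : (1 - r)⁻¹ ≠ ∞ := ENNReal.inv_ne_top.2 (tsub_pos_of_lt hr).ne'
  refine ⟨((1 - r)⁻¹) ^ 6, ENNReal.pow_ne_top hfin, fun {g} hg {ε} hε => ?_⟩
  set a : ℕ × ℕ × ℕ × ℕ × ℕ × ℕ → ℕ := fun α =>
    α.1 + (α.2.1 + (α.2.2.1 + (α.2.2.2.1 + (α.2.2.2.2.1 + α.2.2.2.2.2)))) with ha
  set E : ℕ × ℕ × ℕ × ℕ × ℕ × ℕ → Set (Fin 2 → WG) := fun α =>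
    {x | ∃ k, ENNReal.ofReal (ε * (8 / 7) ^ a α) <
      avgOff (rieszSet (k + α.1, α.2.2.1, α.2.2.2.1))
        (rieszSet (k + α.2.1, α.2.2.2.2.1, α.2.2.2.2.2)) g x} with hE
  have hmono : ∀ u s t, Monotone fun k : ℕ => rieszSet (k + u, s, t) := by
    intro u s t k k' hk
    exact erase_subset_erase _ (Ico_subset_Ico le_rfl (by simpa using hk))
  have hsub : excSet g ε ⊆ ⋃ α, E α := by
    rintro x ⟨⟨i, s, t⟩, ⟨i', s', t'⟩, h⟩
    refine Set.mem_iUnion.2 ⟨(i - i', i' - i, s, t, s', t'), min i i', ?_⟩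
    have e1 : min i i' + (i - i') = i := by omega
    have e2 : min i i' + (i' - i) = i' := by omega
    have e3 : a (i - i', i' - i, s, t, s', t') = lvlExp (i, s, t) (i', s', t') := by
      simp only [ha, lvlExp]; omega
    simp only [e1, e2, e3]
    exact h
  have hEle : ∀ α, μD 2 (E α) ≤ (ENNReal.ofReal ε)⁻¹ * (∫⁻ x, g x ∂μD 2) * r ^ a α := by
    intro α
    have hpos : 0 < ε * (8 / 7) ^ a α := by positivity
    have h1 := weak_type_avgOff (hmono α.1 α.2.2.1 α.2.2.2.1)
      (hmono α.2.1 α.2.2.2.2.1 α.2.2.2.2.2) hg (ENNReal.ofReal (ε * (8 / 7) ^ a α))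
    have h2 : (ENNReal.ofReal (ε * (8 / 7) ^ a α))⁻¹ = (ENNReal.ofReal ε)⁻¹ * r ^ a α := by
      rw [← ENNReal.ofReal_inv_of_pos hpos, ← ENNReal.ofReal_inv_of_pos hε,
        ← ENNReal.ofReal_pow (by norm_num), ← ENNReal.ofReal_mul (by positivity), mul_inv,
        ← inv_pow]
      norm_num
    rw [mul_right_comm, ← h2, ← ENNReal.div_eq_inv_mul,
      ENNReal.le_div_iff_mul_le (Or.inl (ENNReal.ofReal_pos.2 hpos).ne')
        (Or.inl ENNReal.ofReal_ne_top), mul_comm]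
    exact h1
  calc μD 2 (excSet g ε) ≤ ∑' α, μD 2 (E α) := (measure_mono hsub).trans (measure_iUnion_le E)
    _ ≤ ∑' α, (ENNReal.ofReal ε)⁻¹ * (∫⁻ x, g x ∂μD 2) * r ^ a α := ENNReal.tsum_le_tsum hEle
    _ = _ := by
      rw [ENNReal.tsum_mul_left, mul_comm]
      congr 1
      simp only [ha, ENNReal.tsum_prod', pow_add, ENNReal.tsum_mul_left, ENNReal.tsum_mul_right,
        ENNReal.tsum_geometric]
      ring

/-- Dependence on the first `N` coordinates of each variable only. -/
def IsCylinder (N : ℕ) (g : (Fin 2 → WG) → ℝ) : Prop :=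
  ∀ x y, (∀ j, ∀ i < N, x j i = y j i) → g x = g y

lemma fCoeff_eq_zero_of_isCylinder {N : ℕ} {g : (Fin 2 → WG) → ℝ} (hg : IsCylinder N g)
    {m : Fin 2 → ℕ} {j : Fin 2} (hm : 2 ^ N ≤ m j) : fCoeff 2 g m = 0 := by
  have hm0 : m j ≠ 0 := (Nat.pos_of_ne_zero (by positivity)).trans_le hm |>.ne'
  have hN : N ≤ Nat.log 2 (m j) := Nat.le_log_of_pow_le one_lt_two hm
  refine integral_eq_zero_of_antiinvariant (Pi.single j (Pi.single (Nat.log 2 (m j)) 1)) fun z => ?_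
  have h1 : g (Pi.single j (Pi.single (Nat.log 2 (m j)) 1) + z) = g z := by
    refine hg _ _ fun j' i hi => ?_
    have hne : i ≠ Nat.log 2 (m j) := by omega
    by_cases hj : j' = j
    · subst hj; simp [hne]
    · simp [hj]
  have h2 : kaczD 2 m (Pi.single j (Pi.single (Nat.log 2 (m j)) 1)) = -1 := by
    unfold kaczD
    rw [prod_eq_single j, Pi.single_eq_same, kacz_single_log hm0]
    · intro j' _ hj
      rw [Pi.single_eq_of_ne hj]
      by_cases h : m j' = 0
      · rw [h, kacz_zero]
      · obtain ⟨q, hq⟩ := kacz_eq_rad_mul_revWalsh h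
        rw [hq]
        simp [rad, revWalsh]
    · simp
  rw [h1, kaczD_add, h2]
  ring

lemma partialSumOf_two_pow_of_isCylinder {N : ℕ} {g : (Fin 2 → WG) → ℝ}
    (hgi : Integrable g (μD 2)) (hg : IsCylinder N g) (x : Fin 2 → WG) :
    partialSumOf 2 (fCoeff 2 g) (fun _ => 2 ^ N) x = g x := by
  rw [partialSumOf_eq_integral hgi]
  have h : ∀ y, g y * tensor (dirK (2 ^ N)) (dirK (2 ^ N)) (x + y)
      = g x * riesz₂ (range N) (range N) (x + y) := by
    intro y
    have ht : tensor (dirK (2 ^ N)) (dirK (2 ^ N)) (x + y)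
        = riesz₂ (range N) (range N) (x + y) := by
      simp only [tensor, riesz₂, dirK_two_pow]
    rw [ht]
    by_cases hxy : ∀ j, ∀ i < N, x j i = y j i
    · rw [hg x y hxy]
    · push Not at hxy
      obtain ⟨j, i, hi, hne⟩ := hxy
      have h0 : riesz₂ (range N) (range N) (x + y) = 0 := by
        have := riesz_eq_zero (mem_range.2 hi) (WG_add_eq_zero hne)
        unfold riesz₂
        fin_cases j
        · exact mul_eq_zero_of_left this _
        · exact mul_eq_zero_of_right _ this
      rw [h0, mul_zero, mul_zero]
  simp_rw [h]
  rw [integral_const_mul, integral_add_left_eq_self (μ := μD 2) (riesz₂ (range N) (range N)) x,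
    integral_riesz₂, mul_one]

lemma partialSumOf_eq_sum_two_pow {N : ℕ} {c : (Fin 2 → ℕ) → ℝ}
    (hc : ∀ m j, 2 ^ N ≤ m j → c m = 0) (k : Fin 2 → ℕ) (x : Fin 2 → WG) :
    partialSumOf 2 c k x = ∑ m ∈ Fintype.piFinset (fun _ : Fin 2 => range (2 ^ N)),
      c m * kaczD 2 m x * ((if m 0 < k 0 then 1 else 0) * (if m 1 < k 1 then 1 else 0)) := by
  have h1 : ∀ m : Fin 2 → ℕ,
      c m * kaczD 2 m x * ((if m 0 < k 0 then 1 else 0) * (if m 1 < k 1 then 1 else 0))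
        = if m 0 < k 0 ∧ m 1 < k 1 then c m * kaczD 2 m x else 0 := by
    intro m
    split_ifs <;> simp_all
  simp_rw [h1]
  rw [← sum_filter]
  unfold partialSumOf
  symm
  refine sum_subset (fun m hm => ?_) fun m hm hm' => ?_
  · simp only [mem_filter, Fintype.mem_piFinset, mem_range, Fin.forall_fin_two] at hm ⊢
    exact hm.2
  · simp only [mem_filter, Fintype.mem_piFinset, mem_range, Fin.forall_fin_two] at hm hm'
    have : ∃ j, 2 ^ N ≤ m j := by
      by_contra! h
      exact hm' ⟨⟨h 0, h 1⟩, hm⟩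
    obtain ⟨j, hj⟩ := this
    rw [hc m j hj, zero_mul]

lemma sum_Icc_ite_lt (m n : ℕ) :
    ∑ k ∈ Icc 1 n, (if m < k then (1 : ℝ) else 0) = (n - m : ℕ) := by
  have h : {k ∈ Icc 1 n | m < k} = Ioc m n := by
    ext k
    simp only [mem_filter, mem_Icc, mem_Ioc]
    omega
  rw [sum_boole, h, Nat.card_Ioc]

lemma tendsto_cast_tsub_div (m : ℕ) :
    Tendsto (fun n : ℕ => ((n - m : ℕ) : ℝ) / n) atTop (nhds 1) := by
  have h : Tendsto (fun n : ℕ => 1 - (m : ℝ) / n) atTop (nhds 1) := by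
    simpa using tendsto_const_nhds.sub (tendsto_const_div_atTop_nhds_zero_nat (m : ℝ))
  refine h.congr' ?_
  filter_upwards [eventually_ge_atTop m, eventually_gt_atTop 0] with n hn hn0
  have : (n : ℝ) ≠ 0 := by positivity
  rw [Nat.cast_sub hn, sub_div, div_self this]

lemma tendsto_eval_atTop (j : Fin 2) : Tendsto (fun n : Fin 2 → ℕ => n j) atTop atTop :=
  tendsto_atTop.2 fun b => (eventually_ge_atTop fun _ => b).mono fun _ hn => hn j

lemma tendsto_fejer2_of_isCylinder {N : ℕ} {g : (Fin 2 → WG) → ℝ}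
    (hgi : Integrable g (μD 2)) (hg : IsCylinder N g) (x : Fin 2 → WG) :
    Tendsto (fun n => fejer2 g n x) atTop (nhds (g x)) := by
  have hc : ∀ m j, 2 ^ N ≤ m j → fCoeff 2 g m = 0 := fun m j => fCoeff_eq_zero_of_isCylinder hg
  have h : ∀ n, fejer2 g n x = ∑ m ∈ Fintype.piFinset (fun _ : Fin 2 => range (2 ^ N)),
      fCoeff 2 g m * kaczD 2 m x *
        (((n 0 - m 0 : ℕ) : ℝ) / n 0 * (((n 1 - m 1 : ℕ) : ℝ) / n 1)) := by
    intro n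
    unfold fejer2
    simp_rw [partialSumOf_eq_sum_two_pow hc]
    simp only [if_true, one_ne_zero, if_false]
    rw [sum_congr rfl fun k₁ _ => sum_comm, sum_comm, mul_sum]
    refine sum_congr rfl fun m _ => ?_
    simp_rw [← mul_sum, ← sum_mul, sum_Icc_ite_lt]
    ring
  have hlim : Tendsto (fun n : Fin 2 → ℕ =>
      ∑ m ∈ Fintype.piFinset (fun _ : Fin 2 => range (2 ^ N)), fCoeff 2 g m * kaczD 2 m x *
        (((n 0 - m 0 : ℕ) : ℝ) / n 0 * (((n 1 - m 1 : ℕ) : ℝ) / n 1))) atTop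
      (nhds (∑ m ∈ Fintype.piFinset (fun _ : Fin 2 => range (2 ^ N)),
        fCoeff 2 g m * kaczD 2 m x * (1 * 1))) :=
    tendsto_finsetSum _ fun m _ => tendsto_const_nhds.mul
      (((tendsto_cast_tsub_div (m 0)).comp (tendsto_eval_atTop 0)).mul
        ((tendsto_cast_tsub_div (m 1)).comp (tendsto_eval_atTop 1)))
  simp_rw [h]
  convert hlim
  rw [← partialSumOf_two_pow_of_isCylinder hgi hg x]
  simp [partialSumOf]

/-- The algebra of continuous cylinder functions. -/
def cylinderAlg : Subalgebra ℝ C(Fin 2 → WG, ℝ) where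
  carrier := {g | ∃ N, IsCylinder N g}
  mul_mem' := by
    rintro a b ⟨N, ha⟩ ⟨M, hb⟩
    refine ⟨max N M, fun x y h => ?_⟩
    rw [ContinuousMap.mul_apply, ContinuousMap.mul_apply,
      ha x y fun j i hi => h j i (lt_max_of_lt_left hi),
      hb x y fun j i hi => h j i (lt_max_of_lt_right hi)]
  add_mem' := by
    rintro a b ⟨N, ha⟩ ⟨M, hb⟩
    refine ⟨max N M, fun x y h => ?_⟩
    rw [ContinuousMap.add_apply, ContinuousMap.add_apply,
      ha x y fun j i hi => h j i (lt_max_of_lt_left hi),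
      hb x y fun j i hi => h j i (lt_max_of_lt_right hi)]
  algebraMap_mem' := fun _ => ⟨0, fun _ _ _ => rfl⟩

lemma separatesPoints_cylinderAlg : cylinderAlg.SeparatesPoints := by
  intro x y hxy
  obtain ⟨j, hj⟩ := Function.ne_iff.1 hxy
  obtain ⟨i, hi⟩ := Function.ne_iff.1 hj
  refine ⟨fun z => rad i (z j), ⟨⟨fun z => rad i (z j), (continuous_rad i).comp
    (continuous_apply j)⟩, ⟨i + 1, fun z w h => ?_⟩, rfl⟩, fun h => ?_⟩
  · simp only [ContinuousMap.coe_mk, rad, h j i i.lt_succ_self]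
  · simp only at h
    rcases rad_eq i (x j) with ⟨h1, h2⟩ | ⟨h1, h2⟩ <;>
      rcases rad_eq i (y j) with ⟨h3, h4⟩ | ⟨h3, h4⟩ <;>
      first
        | exact hi (h1.trans h3.symm)
        | (rw [h2, h4] at h; norm_num at h)

lemma exists_isCylinder_lintegral_sub_le {f : (Fin 2 → WG) → ℝ} (hf : Integrable f (μD 2))
    {δ : ℝ} (hδ : 0 < δ) : ∃ N g, Continuous g ∧ IsCylinder N g ∧
      ∫⁻ x, ‖f x - g x‖ₑ ∂μD 2 ≤ ENNReal.ofReal δ := by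
  obtain ⟨h, -, hle, hc, -⟩ := hf.exists_hasCompactSupport_lintegral_sub_le
    (ε := ENNReal.ofReal (δ / 2)) (ENNReal.ofReal_pos.2 (half_pos hδ)).ne'
  obtain ⟨⟨g, N, hg⟩, hgh⟩ := ContinuousMap.exists_mem_subalgebra_near_continuous_of_separatesPoints
    cylinderAlg separatesPoints_cylinderAlg h hc (δ / 2) (half_pos hδ)
  refine ⟨N, g, g.continuous, hg, ?_⟩
  calc ∫⁻ x, ‖f x - g x‖ₑ ∂μD 2
      ≤ ∫⁻ x, (‖f x - h x‖ₑ + ENNReal.ofReal (δ / 2)) ∂μD 2 := by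
        refine lintegral_mono fun x => ?_
        rw [← sub_add_sub_cancel (f x) (h x) (g x)]
        refine (enorm_add_le _ _).trans ?_
        gcongr
        rw [← enorm_neg, neg_sub, Real.enorm_eq_ofReal_abs]
        exact ENNReal.ofReal_le_ofReal (hgh x).le
    _ ≤ ENNReal.ofReal (δ / 2) + ENNReal.ofReal (δ / 2) := by
        rw [lintegral_add_right _ measurable_const, lintegral_const, measure_univ, mul_one]
        gcongr
    _ = ENNReal.ofReal δ := by
        rw [← ENNReal.ofReal_add (by positivity) (by positivity), add_halves]

lemma log_le_log_add {a b c : ℕ} {β : ℝ} (hβ : β ≤ 2 ^ c) (ha : a ≠ 0) (hab : (a : ℝ) ≤ β * b) :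
    Nat.log 2 a ≤ Nat.log 2 b + c := by
  have h1 : a ≤ 2 ^ c * b := by
    have : (a : ℝ) ≤ 2 ^ c * b := hab.trans (by gcongr)
    exact_mod_cast this
  have h2 : b < 2 ^ (Nat.log 2 b + 1) := Nat.lt_pow_succ_log_self one_lt_two b
  have h3 : 2 ^ Nat.log 2 a < 2 ^ (Nat.log 2 b + c + 1) :=
    calc 2 ^ Nat.log 2 a ≤ a := Nat.pow_log_le_self 2 ha
      _ ≤ 2 ^ c * b := h1
      _ < 2 ^ c * 2 ^ (Nat.log 2 b + 1) := by gcongr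
      _ = 2 ^ (Nat.log 2 b + c + 1) := by rw [← pow_add]; congr 1; omega
  have := (Nat.pow_lt_pow_iff_right one_lt_two).1 h3
  omega

/-- Indices in the cone of aperture `β`. -/
def coneFilter (β : ℝ) : Filter (Fin 2 → ℕ) :=
  atTop ⊓ 𝓟 {n | β⁻¹ ≤ (n 0 : ℝ) / (n 1 : ℝ) ∧ (n 0 : ℝ) / (n 1 : ℝ) ≤ β}

lemma eventually_coneFilter {β : ℝ} (hβ : 0 < β) : ∀ᶠ n in coneFilter β,
    n 0 ≠ 0 ∧ n 1 ≠ 0 ∧ (n 0 : ℝ) ≤ β * n 1 ∧ (n 1 : ℝ) ≤ β * n 0 := by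
  refine eventually_inf_principal.2 ?_
  filter_upwards [eventually_ge_atTop fun _ => 1] with n hn hcone
  have h0 : 1 ≤ n 0 := hn 0
  have h1 : 1 ≤ n 1 := hn 1
  have h1' : (0 : ℝ) < n 1 := by exact_mod_cast h1
  refine ⟨by omega, by omega, (div_le_iff₀ h1').1 hcone.2, ?_⟩
  have := (le_div_iff₀ h1').1 hcone.1
  rwa [inv_mul_le_iff₀ hβ] at this

lemma ae_eventually_abs_fejer2_sub_le {f : (Fin 2 → WG) → ℝ} (hf : Integrable f (μD 2))
    (hfm : Measurable f) {β : ℝ} (hβ : 0 < β) {c : ℕ} (hc : β ≤ 2 ^ c) {ε : ℝ} (hε : 0 < ε) :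
    ∀ᵐ x ∂μD 2, ∀ᶠ n in coneFilter β,
      |fejer2 f n x - f x| ≤ (81 * (8 / 7) ^ c * 147 ^ 2 + 2) * ε := by
  obtain ⟨C, hC, hexc⟩ := exists_measure_excSet_le
  set B := {x | ¬ ∀ᶠ n in coneFilter β,
    |fejer2 f n x - f x| ≤ (81 * (8 / 7) ^ c * 147 ^ 2 + 2) * ε}
  have hle : ∀ δ : ℝ, 0 < δ →
      μD 2 B ≤ (C + 1) * (ENNReal.ofReal ε)⁻¹ * ENNReal.ofReal δ := by
    intro δ hδ
    obtain ⟨N, g, hgc, hg, hfg⟩ := exists_isCylinder_lintegral_sub_le hf hδ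
    have hgi := integrable_of_continuous hgc
    have hm : Measurable (f - g) := hfm.sub hgc.measurable
    have hsub : B ⊆ excSet (fun x => ‖(f - g) x‖ₑ) ε ∪
        {x | ENNReal.ofReal ε ≤ ‖(f - g) x‖ₑ} := by
      intro x hx
      by_contra hnot
      rw [Set.mem_union, not_or] at hnot
      obtain ⟨hx1, hx2⟩ := hnot
      refine hx ?_
      have hx3 : |f x - g x| ≤ ε := by
        rw [Set.mem_ofPred_eq, not_le, Real.enorm_eq_ofReal_abs] at hx2
        exact (ENNReal.ofReal_le_ofReal_iff hε.le).1 hx2.le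
      have hlim : ∀ᶠ n in coneFilter β, |fejer2 g n x - g x| ≤ ε :=
        (((tendsto_fejer2_of_isCylinder hgi hg x).mono_left inf_le_left).eventually
          (Metric.closedBall_mem_nhds _ hε)).mono fun n hn => hn
      filter_upwards [hlim, eventually_coneFilter hβ] with n hn1 ⟨h0, h1, h01, h10⟩
      have hbd := abs_fejer2_le_of_notMem_excSet (hf.sub hgi) hm (Nat.pow_log_le_self 2 h0)
        (Nat.lt_pow_succ_log_self one_lt_two _).le (Nat.pow_log_le_self 2 h1)
        (Nat.lt_pow_succ_log_self one_lt_two _).le (log_le_log_add hc h0 h01)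
        (log_le_log_add hc h1 h10) hε.le hx1
      rw [fejer2_sub hf hgi] at hbd
      rw [abs_le] at *
      constructor <;> linarith [hbd.1, hbd.2, hn1.1, hn1.2, hx3.1, hx3.2]
    have hmarkov : μD 2 {x | ENNReal.ofReal ε ≤ ‖(f - g) x‖ₑ} ≤
        (ENNReal.ofReal ε)⁻¹ * ∫⁻ x, ‖(f - g) x‖ₑ ∂μD 2 := by
      rw [← ENNReal.div_eq_inv_mul]
      exact meas_ge_le_lintegral_div hm.enorm.aemeasurable (ENNReal.ofReal_pos.2 hε).ne'
        ENNReal.ofReal_ne_top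
    calc μD 2 B ≤ C * ((ENNReal.ofReal ε)⁻¹ * ∫⁻ x, ‖(f - g) x‖ₑ ∂μD 2)
          + (ENNReal.ofReal ε)⁻¹ * ∫⁻ x, ‖(f - g) x‖ₑ ∂μD 2 :=
          (measure_mono hsub).trans ((measure_union_le _ _).trans
            (add_le_add (hexc hm.enorm hε) hmarkov))
      _ = (C + 1) * (ENNReal.ofReal ε)⁻¹ * ∫⁻ x, ‖(f - g) x‖ₑ ∂μD 2 := by ring
      _ ≤ _ := by
        gcongr
        exact hfg
  have hlim : Tendsto (fun δ : ℝ => (C + 1) * (ENNReal.ofReal ε)⁻¹ * ENNReal.ofReal δ)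
      (nhdsWithin 0 (Set.Ioi 0)) (nhds 0) := by
    have h1 : Tendsto ENNReal.ofReal (nhdsWithin 0 (Set.Ioi 0)) (nhds 0) := by
      simpa using (ENNReal.continuous_ofReal.tendsto 0).mono_left nhdsWithin_le_nhds
    have h2 : (C + 1) * (ENNReal.ofReal ε)⁻¹ ≠ ∞ := ENNReal.mul_ne_top (by simp [hC])
      (ENNReal.inv_ne_top.2 (ENNReal.ofReal_pos.2 hε).ne')
    simpa using ENNReal.Tendsto.const_mul h1 (Or.inr h2)
  exact le_antisymm (ge_of_tendsto hlim (eventually_mem_nhdsWithin.mono hle)) zero_le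

lemma fejer2_congr_ae {f g : (Fin 2 → WG) → ℝ} (h : f =ᵐ[μD 2] g) : fejer2 f = fejer2 g := by
  have hcoeff : fCoeff 2 f = fCoeff 2 g := by
    funext m
    exact integral_congr_ae (h.mono fun x hx => by simp only [hx])
  funext n x
  unfold fejer2
  rw [hcoeff]

/-- Simon's theorem: for `f ∈ L¹(G²)` and a fixed `β ≥ 1`, the
two-dimensional Walsh–Kaczmarz–Fejér means converge to `f` a.e. as `min(n₁,n₂) → ∞`
restricted to the cone `β⁻¹ ≤ n₁/n₂ ≤ β`. -/
theorem fejer_cone_ae_convergence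
    (f : (Fin 2 → WG) → ℝ) (hf : Integrable f (μD 2)) (β : ℝ) (hβ : 1 ≤ β) :
    ∀ᵐ x ∂ μD 2,
      Tendsto (fun n => fejer2 f n x)
        (atTop ⊓ 𝓟 {n : Fin 2 → ℕ |
          β⁻¹ ≤ (n 0 : ℝ) / (n 1 : ℝ) ∧ (n 0 : ℝ) / (n 1 : ℝ) ≤ β})
        (nhds (f x)) := by
  obtain ⟨c, hc⟩ := pow_unbounded_of_one_lt β one_lt_two
  have hfm := hf.1.aemeasurable
  have hmk : Integrable (hfm.mk f) (μD 2) := hf.congr hfm.ae_eq_mk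
  set K : ℝ := 81 * (8 / 7) ^ c * 147 ^ 2 + 2 with hK
  have hKpos : 0 < K := by positivity
  have hall := ae_all_iff.2 fun k : ℕ => ae_eventually_abs_fejer2_sub_le hmk
    hfm.measurable_mk (zero_lt_one.trans_le hβ) hc.le (Nat.one_div_pos_of_nat (n := k))
  filter_upwards [hall, hfm.ae_eq_mk] with x hx hfx
  rw [hfx, fejer2_congr_ae hfm.ae_eq_mk]
  refine Metric.tendsto_nhds.2 fun η hη => ?_
  obtain ⟨k, hk⟩ := exists_nat_one_div_lt (div_pos hη hKpos)
  filter_upwards [hx k] with n hn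
  rw [Real.dist_eq]
  refine hn.trans_lt ?_
  rwa [← hK, mul_comm, ← lt_div_iff₀ hKpos]

end
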